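/- Let 𝓑 be the complex Brjuno function. (i) For every irrational α ∈ ℝ, the limit L(α) := lim_{z→α, z∈ℍ} Re 𝓑(z) exists. (ii) For every rational number p/q (in lowest terms, q ≥ 1) there exists a real constant c_{p/q} such that for every θ ∈ (−π/2, π/2): lim_{r→0⁺} Re 𝓑(p/q + r·e^{i(π/2−θ)}) = c_{p/q} − θ/q. (iii) Moreover, lim_{α→(p/q)⁺, α∈ℝ∖ℚ} L(α) = c_{p/q} − π/(2q) and lim_{α→(p/q)⁻, α∈ℝ∖ℚ} L(α) = c_{p/q} + π/(2q); in particular the boundary trace of Re 𝓑 on ℝ is continuous at every irrational point and has a decreasing jump of π/q at each rational point p/q. -/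

import Mathlib

open Complex Filter Set Topology
open scoped ENNReal NNReal

noncomputable section

/-- The complement in `ℂ` of the real segment `[a, b]`. -/
def cutPlane (a b : ℝ) : Set ℂ := (Complex.ofReal '' Set.Icc a b)ᶜ

/-- `𝒪¹(ℂ̄ ∖ [a,b])`: holomorphic on `ℂ ∖ [a,b]`, vanishing at infinity. -/
def O1 (a b : ℝ) : Set (ℂ → ℂ) :=
  {φ | DifferentiableOn ℂ φ (cutPlane a b) ∧
       Tendsto φ (Bornology.cobounded ℂ) (nhds 0)}

/-- `𝒪³(ℂ̄ ∖ [a,b])`: holomorphic on `ℂ ∖ [a,b]`, with `z²ψ(z) → 0` at infinity. -/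
def O3 (a b : ℝ) : Set (ℂ → ℂ) :=
  {ψ | DifferentiableOn ℂ ψ (cutPlane a b) ∧
       Tendsto (fun z => z ^ 2 * ψ z) (Bornology.cobounded ℂ) (nhds 0)}

/-- The `m`-th term (for the integer `m+1 ≥ 1`) of the series defining `T`. -/
def Tterm (φ : ℂ → ℂ) (m : ℕ) (z : ℂ) : ℂ :=
  -z * (φ (z⁻¹ - ((m : ℂ) + 1)) - φ (-((m : ℂ) + 1))) + deriv φ (-((m : ℂ) + 1))

/-- The operator `T`. -/
def Tbrj (φ : ℂ → ℂ) : ℂ → ℂ := fun z => ∑' m : ℕ, Tterm φ m z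

/-- The operator `T⁽³⁾`. -/
def T3brj (ψ : ℂ → ℂ) : ℂ → ℂ := fun z => -∑' m : ℕ, (z⁻¹) ^ 3 * ψ (z⁻¹ - ((m : ℂ) + 1))

/-- `g(m) = (0 1; 1 m)`. -/
def gmat (m : ℤ) : Matrix (Fin 2) (Fin 2) ℤ := !![0, 1; 1, m]

/-- The monoid `ℳ`. -/
def Mmon : Set (Matrix (Fin 2) (Fin 2) ℤ) :=
  {g | g = 1 ∨
    ((g 0 0 * g 1 1 - g 0 1 * g 1 0 = 1 ∨ g 0 0 * g 1 1 - g 0 1 * g 1 0 = -1) ∧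
      g 0 1 ≤ g 1 1 ∧ g 0 0 ≤ g 0 1 ∧ 0 ≤ g 0 0 ∧ g 1 0 ≤ g 1 1 ∧ g 0 0 ≤ g 1 0)}

/-- The operator `L_g` on `𝒪¹(ℂ̄ ∖ [0,1])`, for `g = (a b; c d) ∈ ℳ`. -/
def Lop (g : Matrix (Fin 2) (Fin 2) ℤ) (φ : ℂ → ℂ) : ℂ → ℂ := fun z =>
  if g = 1 then φ z
  else
    ((g 0 0 : ℂ) - (g 1 0 : ℂ) * z) *
        (φ (((g 1 1 : ℂ) * z - (g 0 1 : ℂ)) / ((g 0 0 : ℂ) - (g 1 0 : ℂ) * z)) -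
          φ (-(g 1 1 : ℂ) / (g 1 0 : ℂ))) -
      ((g 0 0 * g 1 1 - g 0 1 * g 1 0 : ℤ) : ℂ) * ((g 1 0 : ℂ))⁻¹ *
        deriv φ (-(g 1 1 : ℂ) / (g 1 0 : ℂ))

/-- `Σ_ℳ φ`, the sum of the family `(L_g φ)_{g ∈ ℳ}`. -/
def sumM (φ : ℂ → ℂ) : ℂ → ℂ := fun z => ∑' g : Mmon, Lop g.1 φ z

/-- The domain `D`. -/
def Dset : Set ℂ :=
  {z | ‖z‖ ≤ 1 ∧ 1 ≤ ‖z - Complex.I‖ ∧ 1 ≤ ‖z + Complex.I‖ ∧ 0 < z.re}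

/-- The domain `D₀`. -/
def D0set : Set ℂ := {z | ‖z + 1‖ ≤ 1 ∧ Real.sqrt 3 / 2 - 1 ≤ z.re}

/-- The domain `D₁`. -/
def D1set : Set ℂ :=
  {z | 1 ≤ ‖z‖ ∧ ‖z - (1 / Real.sqrt 3 : ℝ)‖ ≤ 1 / Real.sqrt 3}

/-- The domain `H₀`. -/
def H0set : Set ℂ := {z | ‖z - Complex.I‖ ≤ 1 ∧ 1 ≤ ‖z + 1‖ ∧ z.im ≤ 1 / 2}

/-- The domain `H₀′`. -/
def H0set' : Set ℂ := {z | (starRingEnd ℂ) z ∈ H0set}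

/-- The domain `Δ`. -/
def Δset : Set ℂ := {z | ‖z‖ ≤ 1 ∧ 1 ≤ ‖z + 1‖ ∧ |z.im| ≤ 1 / 2}

/-- The domain `D∞`. -/
def Dinf : Set ℂ :=
  {z | 1 / 2 < |z.im|} ∪ {z | z.re < Real.sqrt 3 / 2 - 1} ∪
    {z | Real.sqrt 3 / 2 < z.re ∧ 1 / Real.sqrt 3 < ‖z - (1 / Real.sqrt 3 : ℝ)‖}

end

noncomputable section

/-- The principal dilogarithm, `Li₂(z) = −∫₀¹ log(1 − tz)/t dt`. -/
def dilog (z : ℂ) : ℂ := -∫ t in (0 : ℝ)..1, Complex.log (1 - (t : ℂ) * z) / (t : ℂ)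

/-- `φ₀(z) = −(1/π)·Li₂(1/z)`, an element of `𝒪¹(ℂ̄∖[0,1])`. -/
def phi0 (z : ℂ) : ℂ := -(Real.pi : ℂ)⁻¹ * dilog z⁻¹

/-- The complex Brjuno function built from a constant `a₀`:
`𝓑(z) = −iπa₀ + Σ_{n∈ℤ} ( Φ(z−n) − a₀·log((z−n)/(z−n−1)) )` where `Φ = Σ_ℳ φ₀`. -/
def BrjWith (a₀ : ℂ) (z : ℂ) : ℂ :=
  -Complex.I * (Real.pi : ℂ) * a₀ +
    ∑' n : ℤ, (sumM phi0 (z - (n : ℂ)) -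
      a₀ * Complex.log ((z - (n : ℂ)) / (z - (n : ℂ) - 1)))


/-- The constant `a₀ = lim_{y→+∞} iy·Φ(iy)`, `Φ = Σ_ℳ φ₀`. -/
def a0 : ℂ :=
  limUnder atTop (fun y : ℝ => Complex.I * (y : ℂ) * sumM phi0 (Complex.I * (y : ℂ)))

/-- The complex Brjuno function `𝓑` on the upper half-plane. -/
def BrjunoC (z : ℂ) : ℂ := BrjWith a0 z

end

/-- A dominating function for `log (1 - s e) / s`, uniformly in unit complex numbers `e`. -/
noncomputable def logKernelBound (s : ℝ) : ℝ :=
  (Set.Ioc (0 : ℝ) 2).indicator (fun s => 2 * |Real.log (1 - s)|) s + 10 * s ^ (-(1 / 2) : ℝ)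

lemma norm_log_one_sub_div_le {e : ℂ} (he : ‖e‖ = 1) {s : ℝ} (hs : 0 < s) (hs1 : s ≠ 1) :
    ‖Complex.log (1 - s * e) / s‖ ≤ logKernelBound s := by
  have hq : 0 < Real.sqrt s := Real.sqrt_pos.2 hs
  have hqq : Real.sqrt s * Real.sqrt s = s := Real.mul_self_sqrt hs.le
  have hpow : s ^ (-(1 / 2) : ℝ) = (Real.sqrt s)⁻¹ := by
    rw [Real.rpow_neg hs.le, Real.sqrt_eq_rpow]
  have hind0 : 0 ≤ (Set.Ioc (0 : ℝ) 2).indicator (fun s => 2 * |Real.log (1 - s)|) s :=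
    Set.indicator_nonneg (fun _ _ => by positivity) _
  have hnse : ‖(s : ℂ) * e‖ = s := by simp [he, abs_of_pos hs]
  rw [norm_div, Complex.norm_real, Real.norm_of_nonneg hs.le, div_le_iff₀ hs, logKernelBound, hpow,
    add_mul]
  have hinv : 10 * (Real.sqrt s)⁻¹ * s = 10 * Real.sqrt s := by
    field_simp; rw [sq]; exact hqq.symm
  rw [hinv]
  rcases le_or_gt s (1 / 2) with h | h
  · have := Complex.norm_log_one_add_half_le_self (z := -(s * e)) (by rw [norm_neg, hnse]; exact h)
    rw [norm_neg, hnse, ← sub_eq_add_neg] at this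
    have h1 : Real.sqrt s ≤ 1 := Real.sqrt_le_one.2 (by linarith)
    nlinarith [mul_nonneg hind0 hs.le]
  · have hlow : |1 - s| ≤ ‖1 - s * e‖ := by
      have := abs_norm_sub_norm_le (1 : ℂ) (s * e)
      rwa [hnse, norm_one] at this
    have hup : ‖1 - s * e‖ ≤ 1 + s := by
      have := norm_sub_le (1 : ℂ) (s * e)
      rwa [hnse, norm_one] at this
    have hpos : 0 < |1 - s| := abs_pos.2 (sub_ne_zero.2 hs1.symm)
    have hlog1 : Real.log ‖1 - s * e‖ ≤ 2 * Real.sqrt s := by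
      calc Real.log ‖1 - s * e‖ ≤ Real.log ((1 + Real.sqrt s) ^ 2) :=
            Real.log_le_log (hpos.trans_le hlow) (hup.trans (by nlinarith))
        _ = 2 * Real.log (1 + Real.sqrt s) := by rw [Real.log_pow]; norm_num
        _ ≤ 2 * Real.sqrt s := by
            have := Real.log_le_sub_one_of_pos (x := 1 + Real.sqrt s) (by positivity)
            linarith
    have hlog2 : Real.log |1 - s| ≤ Real.log ‖1 - s * e‖ := Real.log_le_log hpos hlow
    rw [Real.log_abs] at hlog2
    have habs : |Real.log ‖1 - s * e‖| ≤
        (Set.Ioc (0 : ℝ) 2).indicator (fun s => 2 * |Real.log (1 - s)|) s * s + 2 * Real.sqrt s := by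
      rcases le_or_gt s 2 with h2 | h2
      · rw [Set.indicator_of_mem (by exact ⟨hs, h2⟩)]
        have h3 := neg_abs_le (Real.log (1 - s))
        have h4 := abs_nonneg (Real.log (1 - s))
        rw [abs_le]
        constructor <;> nlinarith
      · rw [Set.indicator_of_notMem (by simp [h2])]
        have : 0 ≤ Real.log ‖1 - s * e‖ := by
          apply Real.log_nonneg
          refine le_trans ?_ hlow
          rw [abs_sub_comm]
          exact le_trans (by linarith) (le_abs_self _)
        rw [abs_of_nonneg this]; linarith
    have hn := Complex.norm_le_abs_re_add_abs_im (Complex.log (1 - s * e))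
    rw [Complex.log_re, Complex.log_im] at hn
    have harg := Complex.abs_arg_le_pi (1 - s * e)
    have h07 : (0.7 : ℝ) ≤ Real.sqrt s := Real.le_sqrt_of_sq_le (by norm_num; linarith)
    have := Real.pi_lt_d2
    linarith

lemma integrable_indicator_log :
    MeasureTheory.Integrable
      ((Set.Ioc (0 : ℝ) 2).indicator (fun s => 2 * |Real.log (1 - s)|)) := by
  rw [MeasureTheory.integrable_indicator_iff measurableSet_Ioc,
    ← intervalIntegrable_iff_integrableOn_Ioc_of_le (by norm_num)]
  have h : IntervalIntegrable (fun x => Real.log (1 - x)) MeasureTheory.volume 0 2 := by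
    have := (intervalIntegral.intervalIntegrable_log' (a := 1 - 0) (b := 1 - 2)).comp_sub_left 1
    simpa using this
  exact h.abs.const_mul 2

lemma intervalIntegrable_logKernelBound (a b : ℝ) :
    IntervalIntegrable logKernelBound MeasureTheory.volume a b := by
  refine IntervalIntegrable.add integrable_indicator_log.intervalIntegrable ?_
  exact (intervalIntegral.intervalIntegrable_rpow' (by norm_num)).const_mul 10

lemma exists_integral_logKernelBound_le :
    ∃ C : ℝ, 0 < C ∧ ∀ ρ : ℝ, 0 ≤ ρ → ∫ s in (0 : ℝ)..ρ, logKernelBound s ≤ C * Real.sqrt (1 + ρ) := by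
  set I := ∫ s, (Set.Ioc (0 : ℝ) 2).indicator (fun s => 2 * |Real.log (1 - s)|) s
  have hnn : ∀ s, 0 ≤ (Set.Ioc (0 : ℝ) 2).indicator (fun s => 2 * |Real.log (1 - s)|) s :=
    fun s => Set.indicator_nonneg (fun _ _ => by positivity) _
  have hI : 0 ≤ I := MeasureTheory.integral_nonneg hnn
  refine ⟨I + 20, by linarith, fun ρ hρ => ?_⟩
  have h1 : ∫ s in (0 : ℝ)..ρ, (Set.Ioc (0 : ℝ) 2).indicator (fun s => 2 * |Real.log (1 - s)|) s ≤ I := by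
    rw [intervalIntegral.integral_of_le hρ]
    exact MeasureTheory.setIntegral_le_integral integrable_indicator_log (MeasureTheory.ae_of_all _ hnn)
  have h2 : ∫ s in (0 : ℝ)..ρ, 10 * s ^ (-(1 / 2) : ℝ) = 20 * Real.sqrt ρ := by
    rw [intervalIntegral.integral_const_mul, integral_rpow (Or.inl (by norm_num)),
      Real.sqrt_eq_rpow]
    norm_num
    ring
  have h3 : ∫ s in (0 : ℝ)..ρ, logKernelBound s =
      (∫ s in (0 : ℝ)..ρ, (Set.Ioc (0 : ℝ) 2).indicator (fun s => 2 * |Real.log (1 - s)|) s) +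
        ∫ s in (0 : ℝ)..ρ, 10 * s ^ (-(1 / 2) : ℝ) :=
    intervalIntegral.integral_add integrable_indicator_log.intervalIntegrable
      ((intervalIntegral.intervalIntegrable_rpow' (by norm_num)).const_mul 10)
  rw [h3, h2]
  have h4 : Real.sqrt ρ ≤ Real.sqrt (1 + ρ) := Real.sqrt_le_sqrt (by linarith)
  have h5 : 1 ≤ Real.sqrt (1 + ρ) := Real.one_le_sqrt.2 (by linarith)
  nlinarith

lemma ae_real_ne (x : ℝ) : ∀ᵐ s : ℝ, s ≠ x := by
  have := (Set.countable_singleton x).ae_notMem MeasureTheory.volume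
  filter_upwards [this] with s hs using by simpa using hs

lemma measurable_log_one_sub_div (e : ℂ) :
    Measurable fun s : ℝ => Complex.log (1 - (s : ℂ) * e) / (s : ℂ) := by
  fun_prop

lemma norm_div_norm_self {y : ℂ} (hy : y ≠ 0) : ‖y / ‖y‖‖ = 1 := by
  rw [norm_div, Complex.norm_real, norm_norm, div_self (norm_ne_zero_iff.2 hy)]

lemma intervalIntegrable_log_polar {e : ℂ} (he : ‖e‖ = 1) {ρ : ℝ} (hρ : 0 ≤ ρ) :
    IntervalIntegrable (fun s : ℝ => Complex.log (1 - (s : ℂ) * e) / (s : ℂ))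
      MeasureTheory.volume 0 ρ := by
  rw [intervalIntegrable_iff_integrableOn_Ioc_of_le hρ]
  refine MeasureTheory.Integrable.mono'
    ((intervalIntegrable_iff_integrableOn_Ioc_of_le hρ).1 (intervalIntegrable_logKernelBound 0 ρ))
    (measurable_log_one_sub_div e).aestronglyMeasurable ?_
  filter_upwards [MeasureTheory.ae_restrict_mem measurableSet_Ioc,
    MeasureTheory.ae_restrict_of_ae (ae_real_ne 1)] with s hs hs1
  exact norm_log_one_sub_div_le he hs.1 hs1

lemma log_kernel_scale {y : ℂ} (hy : y ≠ 0) (t : ℝ) :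
    Complex.log (1 - (t : ℂ) * y) / (t : ℂ) =
      ‖y‖ • (fun s : ℝ => Complex.log (1 - (s : ℂ) * (y / ‖y‖)) / (s : ℂ)) (t * ‖y‖) := by
  have hn' : (‖y‖ : ℂ) ≠ 0 := by exact_mod_cast norm_ne_zero_iff.2 hy
  simp only [Complex.real_smul, Complex.ofReal_mul]
  have : (t : ℂ) * ‖y‖ * (y / ‖y‖) = t * y := by field_simp
  rw [this]
  field_simp

lemma dilog_zero : dilog 0 = 0 := by simp [dilog]

lemma dilog_eq_polar {y : ℂ} (hy : y ≠ 0) :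
    dilog y = -∫ s in (0 : ℝ)..‖y‖, Complex.log (1 - (s : ℂ) * (y / ‖y‖)) / (s : ℂ) := by
  rw [dilog, intervalIntegral.integral_congr (fun t _ => log_kernel_scale hy t),
    intervalIntegral.integral_smul]
  refine congrArg Neg.neg ((intervalIntegral.smul_integral_comp_mul_right
    (fun s : ℝ => Complex.log (1 - (s : ℂ) * (y / ‖y‖)) / (s : ℂ)) ‖y‖).trans ?_)
  rw [zero_mul, one_mul]

lemma intervalIntegrable_log_kernel (y : ℂ) :
    IntervalIntegrable (fun t : ℝ => Complex.log (1 - (t : ℂ) * y) / (t : ℂ))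
      MeasureTheory.volume 0 1 := by
  rcases eq_or_ne y 0 with rfl | hy
  · simp
  have h := (intervalIntegrable_log_polar (norm_div_norm_self hy) (norm_nonneg y)).comp_mul_right
    (c := ‖y‖)
  have hn : ‖y‖ ≠ 0 := norm_ne_zero_iff.2 hy
  rw [zero_div, div_self hn] at h
  exact (h.smul (‖y‖)).congr (fun t _ => (log_kernel_scale hy t).symm)

lemma exists_norm_dilog_le :
    ∃ C : ℝ, 0 < C ∧ ∀ y : ℂ, ‖dilog y‖ ≤ C * Real.sqrt (1 + ‖y‖) := by
  obtain ⟨C, hC, h⟩ := exists_integral_logKernelBound_le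
  refine ⟨C, hC, fun y => ?_⟩
  rcases eq_or_ne y 0 with rfl | hy
  · rw [dilog_zero, norm_zero]; positivity
  refine le_trans ?_ (h ‖y‖ (norm_nonneg y))
  rw [dilog_eq_polar hy, norm_neg]
  refine intervalIntegral.norm_integral_le_of_norm_le (norm_nonneg y) ?_
    (intervalIntegrable_logKernelBound 0 ‖y‖)
  filter_upwards [ae_real_ne 1] with s hs1 hs
  exact norm_log_one_sub_div_le (norm_div_norm_self hy) hs.1 hs1

lemma logKernelBound_nonneg {s : ℝ} (hs : 0 ≤ s) : 0 ≤ logKernelBound s :=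
  add_nonneg (Set.indicator_nonneg (fun _ _ => by positivity) _) (by positivity)

lemma dilog_re_eq_integral_indicator {y : ℂ} (hy : y ≠ 0) :
    (dilog y).re = -∫ s : ℝ, (Set.Ioc 0 ‖y‖).indicator
      (fun s : ℝ => (Complex.log (1 - (s : ℂ) * (y / ‖y‖)) / (s : ℂ)).re) s := by
  have h := intervalIntegrable_log_polar (norm_div_norm_self hy) (norm_nonneg y)
  rw [dilog_eq_polar hy, Complex.neg_re, MeasureTheory.integral_indicator measurableSet_Ioc,
    intervalIntegral.integral_of_le (norm_nonneg y)]
  rw [intervalIntegrable_iff_integrableOn_Ioc_of_le (norm_nonneg y)] at h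
  exact congrArg Neg.neg (integral_re h).symm

lemma log_re_div (w : ℂ) (s : ℝ) : (Complex.log w / (s : ℂ)).re = Real.log ‖w‖ / s := by
  rw [Complex.div_ofReal_re, Complex.log_re]

lemma continuousAt_dilog_re {y₀ : ℂ} (hy₀ : y₀ ≠ 0) :
    ContinuousAt (fun y => (dilog y).re) y₀ := by
  have hev : ∀ᶠ y in 𝓝 y₀, y ≠ 0 := isOpen_ne.mem_nhds hy₀
  have heq : (fun y => (dilog y).re) =ᶠ[𝓝 y₀] fun y => -∫ s : ℝ, (Set.Ioc 0 ‖y‖).indicator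
      (fun s : ℝ => (Complex.log (1 - (s : ℂ) * (y / ‖y‖)) / (s : ℂ)).re) s := by
    filter_upwards [hev] with y hy using dilog_re_eq_integral_indicator hy
  refine ContinuousAt.congr ?_ heq.symm
  refine ContinuousAt.neg ?_
  have hle : ∀ᶠ y in 𝓝 y₀, ‖y‖ < ‖y₀‖ + 1 :=
    continuous_norm.continuousAt.eventually_lt continuousAt_const (by simp)
  refine MeasureTheory.tendsto_integral_filter_of_dominated_convergence
    ((Set.Ioc 0 (‖y₀‖ + 1)).indicator logKernelBound) ?_ ?_ ?_ ?_
  · refine Eventually.of_forall fun y => ?_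
    exact ((Complex.measurable_re.comp (measurable_log_one_sub_div _)).indicator
      measurableSet_Ioc).aestronglyMeasurable
  · filter_upwards [hev, hle] with y hy hyl
    filter_upwards [ae_real_ne 1] with s hs1
    by_cases hs : s ∈ Set.Ioc 0 ‖y‖
    · rw [Set.indicator_of_mem hs, Set.indicator_of_mem (by exact ⟨hs.1, hs.2.trans hyl.le⟩)]
      exact (Complex.abs_re_le_norm _).trans
        (norm_log_one_sub_div_le (norm_div_norm_self hy) hs.1 hs1)
    · rw [Set.indicator_of_notMem hs, norm_zero]
      by_cases hs' : s ∈ Set.Ioc 0 (‖y₀‖ + 1)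
      · rw [Set.indicator_of_mem hs']; exact logKernelBound_nonneg hs'.1.le
      · rw [Set.indicator_of_notMem hs']
  · rw [MeasureTheory.integrable_indicator_iff measurableSet_Ioc]
    exact (intervalIntegrable_iff_integrableOn_Ioc_of_le (by positivity)).1
      (intervalIntegrable_logKernelBound 0 (‖y₀‖ + 1))
  · filter_upwards [ae_real_ne 1, ae_real_ne ‖y₀‖] with s hs1 hs2
    rcases le_or_gt s 0 with hs | hs
    · have : ∀ y : ℂ, s ∉ Set.Ioc 0 ‖y‖ := fun y h => absurd h.1 (not_lt.2 hs)
      simp [this]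
    rcases lt_or_gt_of_ne hs2 with h | h
    · have h1 : ∀ᶠ y in 𝓝 y₀, s < ‖y‖ :=
        continuousAt_const.eventually_lt continuous_norm.continuousAt h
      rw [Set.indicator_of_mem (by exact ⟨hs, h.le⟩)]
      have hne : ‖1 - (s : ℂ) * (y₀ / ‖y₀‖)‖ ≠ 0 := by
        intro h0
        rw [norm_eq_zero, sub_eq_zero] at h0
        have := congrArg norm h0
        rw [norm_mul, norm_div_norm_self hy₀, norm_one, Complex.norm_real,
          Real.norm_of_nonneg hs.le, mul_one] at this
        exact hs1 this.symm
      have hc : ContinuousAt (fun y : ℂ => Real.log ‖1 - (s : ℂ) * (y / ‖y‖)‖ / s) y₀ := by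
        have : (‖y₀‖ : ℂ) ≠ 0 := by exact_mod_cast norm_ne_zero_iff.2 hy₀
        have hc0 : ContinuousAt (fun y : ℂ => ‖1 - (s : ℂ) * (y / ‖y‖)‖) y₀ := by
          fun_prop (disch := assumption)
        exact (hc0.log hne).div_const s
      have hc' := hc.tendsto
      simp only [log_re_div]
      refine hc'.congr' ?_
      filter_upwards [h1] with y hy
      rw [Set.indicator_of_mem (by exact ⟨hs, hy.le⟩)]
    · have h1 : ∀ᶠ y in 𝓝 y₀, ‖y‖ < s :=
        continuous_norm.continuousAt.eventually_lt continuousAt_const h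
      rw [Set.indicator_of_notMem (by simp [h])]
      refine tendsto_const_nhds.congr' ?_
      filter_upwards [h1] with y hy
      rw [Set.indicator_of_notMem (by simp [hy])]

/-- The derivative of the dilogarithm, as an integral. -/
noncomputable def dilogDeriv (y : ℂ) : ℂ := ∫ t in (0 : ℝ)..1, (1 - (t : ℂ) * y)⁻¹

lemma one_sub_mul_mem_slitPlane {y : ℂ} (hy : 1 - y ∈ slitPlane) {t : ℝ} (ht : t ∈ Set.Icc (0 : ℝ) 1) :
    1 - (t : ℂ) * y ∈ slitPlane := by
  have := Complex.starConvex_one_slitPlane hy (a := 1 - t) (b := t) (by linarith [ht.2]) ht.1 (by ring)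
  convert this using 1
  simp only [Complex.real_smul, Complex.ofReal_sub, Complex.ofReal_one]
  ring

lemma isOpen_one_sub_mem_slitPlane : IsOpen {y : ℂ | 1 - y ∈ slitPlane} :=
  Complex.isOpen_slitPlane.preimage (by fun_prop)

lemma exists_lower_bound_one_sub_mul {y₀ : ℂ} (hy : 1 - y₀ ∈ slitPlane) :
    ∃ δ > 0, ∀ y ∈ Metric.ball y₀ δ, 1 - y ∈ slitPlane ∧ ∀ t ∈ Set.Icc (0 : ℝ) 1,
      δ ≤ ‖1 - (t : ℂ) * y‖ := by
  obtain ⟨ε, hε, hball⟩ := Metric.isOpen_iff.1 isOpen_one_sub_mem_slitPlane y₀ hy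
  obtain ⟨t₀, ht₀, hmin⟩ := isCompact_Icc.exists_isMinOn (Set.nonempty_Icc.2 (zero_le_one (α := ℝ)))
    (f := fun t : ℝ => ‖1 - (t : ℂ) * y₀‖) (by fun_prop)
  have hpos : 0 < ‖1 - (t₀ : ℂ) * y₀‖ :=
    norm_pos_iff.2 (slitPlane_ne_zero (one_sub_mul_mem_slitPlane hy ht₀))
  refine ⟨min ε (‖1 - (t₀ : ℂ) * y₀‖ / 2), by positivity, fun y hyb => ⟨?_, fun t ht => ?_⟩⟩
  · exact hball (Metric.ball_subset_ball (min_le_left _ _) hyb)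
  · have h1 : ‖1 - (t₀ : ℂ) * y₀‖ ≤ ‖1 - (t : ℂ) * y₀‖ := hmin ht
    have h2 : ‖y - y₀‖ < ‖1 - (t₀ : ℂ) * y₀‖ / 2 := by
      rw [← dist_eq_norm]; exact (Metric.mem_ball.1 hyb).trans_le (min_le_right _ _)
    have h3 : 1 - (t : ℂ) * y₀ = (1 - (t : ℂ) * y) + t * (y - y₀) := by ring
    have h4 : ‖(t : ℂ) * (y - y₀)‖ ≤ ‖y - y₀‖ := by
      rw [norm_mul, Complex.norm_real, Real.norm_of_nonneg ht.1]
      exact mul_le_of_le_one_left (norm_nonneg _) ht.2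
    have h5 := norm_add_le (1 - (t : ℂ) * y) (t * (y - y₀))
    rw [← h3] at h5
    have := min_le_right ε (‖1 - (t₀ : ℂ) * y₀‖ / 2)
    linarith

lemma hasDerivAt_dilog {y₀ : ℂ} (hy : 1 - y₀ ∈ slitPlane) :
    HasDerivAt dilog (dilogDeriv y₀) y₀ := by
  obtain ⟨δ, hδ, hb⟩ := exists_lower_bound_one_sub_mul hy
  have key := intervalIntegral.hasDerivAt_integral_of_dominated_loc_of_deriv_le
    (μ := MeasureTheory.volume) (a := 0) (b := 1)
    (F := fun (y : ℂ) (t : ℝ) => Complex.log (1 - (t : ℂ) * y) / (t : ℂ))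
    (F' := fun (y : ℂ) (t : ℝ) => -(1 - (t : ℂ) * y)⁻¹) (x₀ := y₀)
    (bound := fun _ => δ⁻¹) (Metric.ball_mem_nhds y₀ hδ)
    (Eventually.of_forall fun y => (measurable_log_one_sub_div y).aestronglyMeasurable)
    (intervalIntegrable_log_kernel y₀)
    (Measurable.aestronglyMeasurable (by fun_prop))
    (MeasureTheory.ae_of_all _ fun t ht y hyb => by
      rw [uIoc_of_le zero_le_one] at ht
      rw [norm_neg, norm_inv]
      exact inv_anti₀ hδ ((hb y hyb).2 t ⟨ht.1.le, ht.2⟩))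
    (by simp)
    (MeasureTheory.ae_of_all _ fun t ht y hyb => by
      rw [uIoc_of_le zero_le_one] at ht
      have ht0 : (t : ℂ) ≠ 0 := by exact_mod_cast ht.1.ne'
      have h1 : HasDerivAt (fun y : ℂ => 1 - (t : ℂ) * y) (-t) y := by
        simpa using ((hasDerivAt_id y).const_mul (t : ℂ)).const_sub 1
      have h2 := (h1.clog (one_sub_mul_mem_slitPlane (hb y hyb).1 ⟨ht.1.le, ht.2⟩)).div_const (t : ℂ)
      refine h2.congr_deriv ?_
      field_simp)
  have h := key.2.neg
  rw [intervalIntegral.integral_neg, neg_neg] at h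
  exact h

lemma mul_dilogDeriv {y : ℂ} (hy : 1 - y ∈ slitPlane) :
    y * dilogDeriv y = -Complex.log (1 - y) := by
  have hs : ∀ t ∈ Set.uIcc (0 : ℝ) 1, 1 - (t : ℂ) * y ∈ slitPlane := fun t ht =>
    one_sub_mul_mem_slitPlane hy (by rwa [Set.uIcc_of_le zero_le_one] at ht)
  have h : ∫ t in (0 : ℝ)..1, y * (1 - (t : ℂ) * y)⁻¹ =
      -Complex.log (1 - ((1 : ℝ) : ℂ) * y) - -Complex.log (1 - ((0 : ℝ) : ℂ) * y) := by
    refine intervalIntegral.integral_eq_sub_of_hasDerivAt (f := fun t : ℝ => -Complex.log (1 - (t : ℂ) * y))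
      (fun t ht => ?_) ?_
    · have h1 : HasDerivAt (fun t : ℝ => 1 - (t : ℂ) * y) (-y) t := by
        simpa using ((Complex.ofRealCLM.hasDerivAt (x := t)).mul_const y).const_sub 1
      have h2 := (h1.clog_real (hs t ht)).neg
      refine h2.congr_deriv ?_
      rw [neg_div, neg_neg, div_eq_mul_inv]
    · refine ContinuousOn.intervalIntegrable fun t ht => ?_
      have := slitPlane_ne_zero (hs t ht)
      exact ContinuousAt.continuousWithinAt (by fun_prop (disch := assumption))
  rw [intervalIntegral.integral_const_mul] at h
  simpa [dilogDeriv] using h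

lemma dilogDeriv_eq {y : ℂ} (hy : 1 - y ∈ slitPlane) (h0 : y ≠ 0) :
    dilogDeriv y = -Complex.log (1 - y) / y := by
  rw [← mul_dilogDeriv hy]; field_simp

lemma mem_slitPlane_of_im_ne {y : ℂ} (hy : y.im ≠ 0) : 1 - y ∈ slitPlane :=
  Or.inr (by simpa using hy)

lemma log_one_sub_add {y : ℂ} (hy : 0 < y.im) :
    Complex.log (1 - y) = Complex.log (-y) + Complex.log (1 - y⁻¹) := by
  have hy0 : y ≠ 0 := by rintro rfl; simp at hy
  have h1 : -y * (1 - y⁻¹) = 1 - y := by field_simp; ring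
  have hi : 0 < (1 - y⁻¹).im := by
    simp only [Complex.sub_im, Complex.one_im, Complex.inv_im, zero_sub]
    rw [neg_div, neg_neg]
    exact div_pos hy (normSq_pos.2 hy0)
  have hne : 1 - y⁻¹ ≠ 0 := by intro h; rw [h] at hi; simp at hi
  rw [← h1, Complex.log_mul (neg_ne_zero.2 hy0) hne]
  have ha : (-y).arg < 0 := Complex.arg_neg_iff.2 (by simpa using hy)
  have hb : 0 ≤ (1 - y⁻¹).arg := Complex.arg_nonneg_iff.2 hi.le
  have hc := Complex.neg_pi_lt_arg (-y)
  have hd := Complex.arg_le_pi (1 - y⁻¹)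
  constructor <;> linarith

lemma hasDerivAt_dilog_inversion {y : ℂ} (hy : 0 < y.im) :
    HasDerivAt (fun y => dilog y + dilog y⁻¹ + Complex.log (-y) ^ 2 / 2) 0 y := by
  have hy0 : y ≠ 0 := by rintro rfl; simp at hy
  have hi : (y⁻¹).im ≠ 0 := by
    rw [Complex.inv_im]
    exact div_ne_zero (neg_ne_zero.2 hy.ne') (normSq_pos.2 hy0).ne'
  have h1 := hasDerivAt_dilog (mem_slitPlane_of_im_ne hy.ne')
  have h2 := (hasDerivAt_dilog (mem_slitPlane_of_im_ne hi)).comp y (hasDerivAt_inv hy0)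
  have h3 := (((hasDerivAt_id y).neg.clog (x := y) (Or.inr (by simpa using hy.ne'))).pow 2).div_const 2
  refine ((h1.add h2).add h3).congr_deriv ?_
  rw [dilogDeriv_eq (mem_slitPlane_of_im_ne hy.ne') hy0,
    dilogDeriv_eq (mem_slitPlane_of_im_ne hi) (inv_ne_zero hy0), log_one_sub_add hy]
  simp
  field_simp
  ring

/-- The absolute value of the argument, as a function continuous away from `0`. -/
noncomputable def absArg (z : ℂ) : ℝ := InnerProductGeometry.angle (1 : ℂ) z

lemma absArg_eq {z : ℂ} (hz : z ≠ 0) : absArg z = |z.arg| :=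
  Complex.angle_one_left hz

lemma continuousAt_absArg {z : ℂ} (hz : z ≠ 0) : ContinuousAt absArg z := by
  have := InnerProductGeometry.continuousAt_angle (x := ((1 : ℂ), z)) one_ne_zero hz
  exact this.comp (f := fun z : ℂ => ((1 : ℂ), z)) (by fun_prop)

lemma absArg_neg (z : ℂ) : absArg (-z) = Real.pi - absArg z :=
  InnerProductGeometry.angle_neg_right _ _

lemma absArg_nonneg (z : ℂ) : 0 ≤ absArg z := InnerProductGeometry.angle_nonneg _ _

lemma absArg_le_pi (z : ℂ) : absArg z ≤ Real.pi := InnerProductGeometry.angle_le_pi _ _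

lemma absArg_smul {r : ℝ} (hr : 0 < r) (z : ℂ) : absArg (r * z) = absArg z := by
  have := InnerProductGeometry.angle_smul_right_of_pos (1 : ℂ) z hr
  rwa [Complex.real_smul] at this

lemma absArg_conj (z : ℂ) : absArg ((starRingEnd ℂ) z) = absArg z := by
  rcases eq_or_ne z 0 with rfl | hz
  · simp
  rw [absArg_eq hz, absArg_eq (by simpa using hz), Complex.arg_conj]
  split_ifs with h
  · rw [h]
  · exact abs_neg _

lemma dilog_re (y : ℂ) : (dilog y).re = -∫ t in (0 : ℝ)..1, Real.log ‖1 - (t : ℂ) * y‖ / t := by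
  have h := intervalIntegrable_log_kernel y
  rw [dilog, Complex.neg_re, intervalIntegral.integral_of_le zero_le_one,
    intervalIntegral.integral_of_le zero_le_one]
  rw [intervalIntegrable_iff_integrableOn_Ioc_of_le zero_le_one] at h
  simp only [← log_re_div]
  exact congrArg Neg.neg (integral_re h).symm

lemma dilog_conj_re (y : ℂ) : (dilog ((starRingEnd ℂ) y)).re = (dilog y).re := by
  rw [dilog_re, dilog_re]
  congr 2
  ext t
  rw [← Complex.norm_conj]
  simp

lemma continuous_dilog_re : Continuous fun y => (dilog y).re := by
  rw [continuous_iff_continuousAt]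
  intro y
  rcases eq_or_ne y 0 with rfl | hy
  · exact Complex.continuous_re.continuousAt.comp
      (hasDerivAt_dilog (y₀ := 0) (by simp)).continuousAt
  · exact continuousAt_dilog_re hy

lemma exists_dilog_re_inversion :
    ∃ c : ℝ, ∀ y : ℂ, y ≠ 0 → (dilog y).re + (dilog y⁻¹).re +
      (Real.log ‖y‖ ^ 2 - absArg (-y) ^ 2) / 2 = c := by
  set E : ℂ → ℝ := fun y => (dilog y).re + (dilog y⁻¹).re +
      (Real.log ‖y‖ ^ 2 - absArg (-y) ^ 2) / 2 with hE
  set f : ℂ → ℂ := fun y => dilog y + dilog y⁻¹ + Complex.log (-y) ^ 2 / 2 with hf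
  have hfE : ∀ y : ℂ, y ≠ 0 → E y = (f y).re := by
    intro y hy
    simp only [hE, hf, Complex.add_re]
    have h2 : (Complex.log (-y) ^ 2 / 2).re = (Complex.log (-y) ^ 2).re / 2 :=
      Complex.div_ofReal_re _ 2
    rw [absArg_eq (neg_ne_zero.2 hy), sq_abs, h2, sq (Complex.log (-y)), Complex.mul_re, Complex.log_re, Complex.log_im, norm_neg]
    ring
  have hup : ∀ y : ℂ, 0 < y.im → f y = f Complex.I := by
    intro y hy
    have hconv : Convex ℝ {z : ℂ | 0 < z.im} := convex_halfSpace_im_gt 0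
    have := hconv.norm_image_sub_le_of_norm_hasDerivWithin_le (f := f) (f' := fun _ => 0) (C := 0)
      (fun z hz => (hasDerivAt_dilog_inversion hz).hasDerivWithinAt) (by simp)
      (show Complex.I ∈ {z : ℂ | 0 < z.im} by simp) (show y ∈ {z : ℂ | 0 < z.im} from hy)
    rw [zero_mul, norm_le_zero_iff, sub_eq_zero] at this
    exact this
  have hconj : ∀ y, E ((starRingEnd ℂ) y) = E y := by
    intro y
    simp only [hE]
    rw [dilog_conj_re, ← map_inv₀, dilog_conj_re, ← map_neg, absArg_conj, Complex.norm_conj]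
  have hne : ∀ y : ℂ, y.im ≠ 0 → E y = E Complex.I := by
    have h1 : ∀ y : ℂ, 0 < y.im → E y = E Complex.I := by
      intro y hy
      have : y ≠ 0 := by rintro rfl; simp at hy
      rw [hfE y this, hfE _ Complex.I_ne_zero, hup y hy]
    intro y hy
    rcases lt_or_gt_of_ne hy with h | h
    · rw [← hconj]; exact h1 _ (by simpa using h)
    · exact h1 y h
  refine ⟨E Complex.I, fun y hy => ?_⟩
  by_cases him : y.im = 0
  swap
  · exact hne y him
  have hcont : ContinuousAt E y := by
    have h1 : ContinuousAt (fun y : ℂ => (dilog y⁻¹).re) y :=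
      continuous_dilog_re.continuousAt.comp (continuousAt_inv₀ hy)
    have h2 : ContinuousAt (fun y : ℂ => absArg (-y)) y :=
      ContinuousAt.comp (continuousAt_absArg (neg_ne_zero.2 hy)) continuousAt_neg
    have h3 : ContinuousAt (fun y : ℂ => Real.log ‖y‖) y :=
      continuous_norm.continuousAt.log (norm_ne_zero_iff.2 hy)
    exact (continuous_dilog_re.continuousAt.add h1).add (((h3.pow 2).sub (h2.pow 2)).div_const 2)
  have hseq : Tendsto (fun s : ℝ => y + s * Complex.I) (𝓝[>] 0) (𝓝 y) := by
    have : Continuous (fun s : ℝ => y + s * Complex.I) := by fun_prop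
    have := this.tendsto 0
    simp only [Complex.ofReal_zero, zero_mul, add_zero] at this
    exact this.mono_left nhdsWithin_le_nhds
  refine tendsto_nhds_unique (hcont.tendsto.comp hseq) (tendsto_const_nhds.congr' ?_)
  filter_upwards [self_mem_nhdsWithin] with s hs
  refine (hne _ ?_).symm
  simp [him, (show (0 : ℝ) < s from hs).ne']

/-- The function `y ↦ y Li₂(y)`. -/
noncomputable def mulDilog (y : ℂ) : ℂ := y * dilog y

/-- The scale-invariant form of the functions `L_g φ₀`: the value at `1 / X` of the second-order
Taylor remainder of `mulDilog` at `-l`, rescaled. -/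
noncomputable def brjKernel (l : ℝ) (X : ℂ) : ℂ :=
  X / Real.pi * (mulDilog (-l - X⁻¹) - mulDilog (-l) + deriv mulDilog (-l) * X⁻¹)

/-- The coefficient of `1 / X` in `brjKernel l X` at infinity. -/
noncomputable def brjCoeff (l : ℝ) : ℂ := deriv (deriv mulDilog) (-l) / (2 * Real.pi)

lemma norm_taylor_remainder_le {f : ℂ → ℂ} {Ω S : Set ℂ} (hΩ : IsOpen Ω) (hSΩ : S ⊆ Ω)
    (hS : Convex ℝ S) (hf : DifferentiableOn ℂ f Ω) {M : ℝ}
    (hM : ∀ z ∈ S, ‖deriv (deriv (deriv f)) z‖ ≤ M) {c z : ℂ} (hc : c ∈ S) (hz : z ∈ S) :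
    ‖f z - f c - deriv f c * (z - c) - deriv (deriv f) c * (z - c) ^ 2 / 2‖ ≤ M * ‖z - c‖ ^ 3 := by
  have hf1 := hf.deriv hΩ
  have hf2 := hf1.deriv hΩ
  have hd : ∀ {g : ℂ → ℂ}, DifferentiableOn ℂ g Ω → ∀ w ∈ S, HasDerivAt g (deriv g w) w :=
    fun hg w hw => ((hg w (hSΩ hw)).differentiableAt (hΩ.mem_nhds (hSΩ hw))).hasDerivAt
  have hM0 : 0 ≤ M := (norm_nonneg _).trans (hM c hc)
  set T := S ∩ Metric.closedBall c ‖z - c‖ with hT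
  have hTc : Convex ℝ T := hS.inter (convex_closedBall _ _)
  have hcT : c ∈ T := ⟨hc, by simp⟩
  have hzT : z ∈ T := ⟨hz, by simp [dist_eq_norm]⟩
  have hnT : ∀ w ∈ T, ‖w - c‖ ≤ ‖z - c‖ := fun w hw => by
    have := hw.2; rwa [Metric.mem_closedBall, dist_eq_norm] at this
  have e2 : ∀ w ∈ T, ‖deriv (deriv f) w - deriv (deriv f) c‖ ≤ M * ‖z - c‖ := by
    intro w hw
    refine (hTc.norm_image_sub_le_of_norm_hasDerivWithin_le
      (fun w hw => (hd hf2 w hw.1).hasDerivWithinAt) (fun w hw => hM w hw.1) hcT hw).trans ?_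
    exact mul_le_mul_of_nonneg_left (hnT w hw) hM0
  have e1 : ∀ w ∈ T, ‖deriv f w - deriv f c - deriv (deriv f) c * (w - c)‖ ≤ M * ‖z - c‖ ^ 2 := by
    intro w hw
    have := hTc.norm_image_sub_le_of_norm_hasDerivWithin_le
      (f := fun w => deriv f w - deriv f c - deriv (deriv f) c * (w - c))
      (f' := fun w => deriv (deriv f) w - deriv (deriv f) c)
      (fun w hw => by
        have h2 : HasDerivAt (fun w => deriv (deriv f) c * (w - c)) (deriv (deriv f) c) w := by
          simpa using ((hasDerivAt_id w).sub_const c).const_mul (deriv (deriv f) c)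
        exact (((hd hf1 w hw.1).sub_const _).sub h2).hasDerivWithinAt) e2 hcT hw
    simp only [sub_self, mul_zero, sub_zero] at this
    refine this.trans ?_
    rw [sq, ← mul_assoc]
    exact mul_le_mul_of_nonneg_left (hnT w hw) (by positivity)
  have := hTc.norm_image_sub_le_of_norm_hasDerivWithin_le
      (f := fun w => f w - f c - deriv f c * (w - c) - deriv (deriv f) c * (w - c) ^ 2 / 2)
      (f' := fun w => deriv f w - deriv f c - deriv (deriv f) c * (w - c))
      (fun w hw => by
        have h1 : HasDerivAt (fun w => deriv f c * (w - c)) (deriv f c) w := by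
          simpa using ((hasDerivAt_id w).sub_const c).const_mul (deriv f c)
        have h2 : HasDerivAt (fun w => deriv (deriv f) c * (w - c) ^ 2 / 2)
            (deriv (deriv f) c * (w - c)) w := by
          have := ((((hasDerivAt_id w).sub_const c).pow 2).const_mul (deriv (deriv f) c)).div_const 2
          refine this.congr_deriv ?_
          simp; ring
        exact ((((hd hf w hw.1).sub_const _).sub h1).sub h2).hasDerivWithinAt) e1 hcT hzT
  simp only [sub_self, mul_zero, sub_zero, ne_eq, OfNat.ofNat_ne_zero, not_false_eq_true, zero_pow,
    zero_div] at this
  refine this.trans (le_of_eq ?_)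
  ring

lemma differentiableOn_mulDilog : DifferentiableOn ℂ mulDilog {y : ℂ | y.re < 1} := by
  intro y hy
  have : 1 - y ∈ slitPlane := Or.inl (by simpa using hy)
  exact (differentiableAt_id.mul (hasDerivAt_dilog this).differentiableAt).differentiableWithinAt

lemma exists_mulDilog_taylor :
    ∃ M : ℝ, 0 < M ∧ ∀ l ∈ Set.Icc (0 : ℝ) 1,
      ‖mulDilog (-l)‖ ≤ M ∧ ‖deriv mulDilog (-l)‖ ≤ M ∧ ‖deriv (deriv mulDilog) (-l)‖ ≤ M ∧
      ∀ h : ℂ, ‖h‖ ≤ 1 / 2 → ‖mulDilog (-l - h) - mulDilog (-l) + deriv mulDilog (-l) * h -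
        deriv (deriv mulDilog) (-l) * h ^ 2 / 2‖ ≤ M * ‖h‖ ^ 3 := by
  set S : Set ℂ := Metric.closedBall 0 2 ∩ {y : ℂ | y.re ≤ 1 / 2} with hS
  have hSc : IsCompact S :=
    (isCompact_closedBall 0 2).inter_right (isClosed_le Complex.continuous_re continuous_const)
  have hΩ : IsOpen {y : ℂ | y.re < 1} := isOpen_lt Complex.continuous_re continuous_const
  have hSΩ : S ⊆ {y : ℂ | y.re < 1} := fun y hy =>
    show y.re < 1 from lt_of_le_of_lt (show y.re ≤ 1 / 2 from hy.2) (by norm_num)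
  have hconv : Convex ℝ S := (convex_closedBall _ _).inter (convex_halfSpace_re_le _)
  have f0 := differentiableOn_mulDilog
  have f1 := f0.deriv hΩ
  have f2 := f1.deriv hΩ
  have f3 := f2.deriv hΩ
  obtain ⟨M0, h0⟩ := hSc.exists_bound_of_continuousOn (f0.continuousOn.mono hSΩ)
  obtain ⟨M1, h1⟩ := hSc.exists_bound_of_continuousOn (f1.continuousOn.mono hSΩ)
  obtain ⟨M2, h2⟩ := hSc.exists_bound_of_continuousOn (f2.continuousOn.mono hSΩ)
  obtain ⟨M3, h3⟩ := hSc.exists_bound_of_continuousOn (f3.continuousOn.mono hSΩ)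
  refine ⟨|M0| + |M1| + |M2| + |M3| + 1, by positivity, fun l hl => ?_⟩
  have a0 := le_abs_self M0
  have a1 := le_abs_self M1
  have a2 := le_abs_self M2
  have a3 := le_abs_self M3
  have b0 := abs_nonneg M0
  have b1 := abs_nonneg M1
  have b2 := abs_nonneg M2
  have b3 := abs_nonneg M3
  have hln : ‖(-l : ℂ)‖ ≤ 1 := by
    rw [norm_neg, Complex.norm_real, Real.norm_of_nonneg hl.1]; exact hl.2
  have hlS : (-l : ℂ) ∈ S := by
    refine ⟨by rw [mem_closedBall_zero_iff]; linarith, ?_⟩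
    simp only [Set.mem_ofPred_eq, Complex.neg_re, Complex.ofReal_re]
    linarith [hl.1]
  refine ⟨by linarith [h0 _ hlS], by linarith [h1 _ hlS], by linarith [h2 _ hlS], fun h hh => ?_⟩
  have hhS : (-l - h : ℂ) ∈ S := by
    refine ⟨?_, ?_⟩
    · rw [mem_closedBall_zero_iff]
      linarith [norm_sub_le (-l : ℂ) h]
    · simp only [Set.mem_ofPred_eq, Complex.sub_re, Complex.neg_re, Complex.ofReal_re]
      linarith [hl.1, neg_abs_le h.re, Complex.abs_re_le_norm h]
  have := norm_taylor_remainder_le hΩ hSΩ hconv f0 (M := |M0| + |M1| + |M2| + |M3| + 1)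
    (fun z hz => by linarith [h3 z hz]) hlS hhS
  have e : (-l - h - -l : ℂ) = -h := by ring
  rw [e, norm_neg] at this
  convert this using 2
  ring

lemma brjKernel_expansion (l : ℝ) {X : ℂ} (hX : X ≠ 0) :
    (Real.pi : ℂ) * brjKernel l X =
      -(1 + l * X) * dilog (-l - X⁻¹) - X * mulDilog (-l) + deriv mulDilog (-l) := by
  have : (Real.pi : ℂ) ≠ 0 := by exact_mod_cast Real.pi_ne_zero
  simp only [brjKernel, mulDilog]
  field_simp
  ring

lemma norm_dilog_arg_le {C : ℝ} (hC : 0 < C) (h : ∀ y : ℂ, ‖dilog y‖ ≤ C * Real.sqrt (1 + ‖y‖))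
    {l : ℝ} (hl : l ∈ Set.Icc (0 : ℝ) 1) {X : ℂ} (hX : X ≠ 0) (hX2 : ‖X‖ ≤ 2) :
    ‖dilog (-l - X⁻¹)‖ ≤ C * Real.sqrt (5 / ‖X‖) := by
  have hpos : 0 < ‖X‖ := norm_pos_iff.2 hX
  refine (h _).trans (mul_le_mul_of_nonneg_left (Real.sqrt_le_sqrt ?_) hC.le)
  have h1 := norm_sub_le (-l : ℂ) X⁻¹
  rw [norm_neg, Complex.norm_real, Real.norm_of_nonneg hl.1, norm_inv] at h1
  have h2 : 1 + (1 + ‖X‖⁻¹) ≤ 5 / ‖X‖ := by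
    rw [le_div_iff₀ hpos]
    have := inv_mul_cancel₀ hpos.ne'
    nlinarith
  linarith [hl.2]

lemma exists_norm_brjKernel_sub_le :
    ∃ C : ℝ, 0 < C ∧ ∀ l ∈ Set.Icc (0 : ℝ) 1, ‖brjCoeff l‖ ≤ C ∧
      (∀ X : ℂ, X ≠ 0 → ‖brjKernel l X‖ ≤ C / ‖X‖) ∧
      ∀ X : ℂ, 2 ≤ ‖X‖ → ‖brjKernel l X - brjCoeff l / X‖ ≤ C / ‖X‖ ^ 2 := by
  obtain ⟨M, hM, h⟩ := exists_mulDilog_taylor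
  obtain ⟨D, hD, hdil⟩ := exists_norm_dilog_le
  have hpi : (1 : ℝ) ≤ Real.pi := by linarith [Real.pi_gt_three]
  have hpi0 : (Real.pi : ℂ) ≠ 0 := by exact_mod_cast Real.pi_ne_zero
  have hfar : ∀ l ∈ Set.Icc (0 : ℝ) 1, ∀ X : ℂ, 2 ≤ ‖X‖ →
      ‖brjKernel l X - brjCoeff l / X‖ ≤ M / ‖X‖ ^ 2 := by
    intro l hl X hX
    have hpos : 0 < ‖X‖ := by linarith
    have hX0 : X ≠ 0 := norm_pos_iff.1 hpos
    have h1 := (h l hl).2.2.2 X⁻¹ (by rw [norm_inv, one_div]; exact inv_anti₀ (by norm_num) hX)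
    have e : brjKernel l X - brjCoeff l / X = X / Real.pi * (mulDilog (-l - X⁻¹) - mulDilog (-l) +
        deriv mulDilog (-l) * X⁻¹ - deriv (deriv mulDilog) (-l) * X⁻¹ ^ 2 / 2) := by
      simp only [brjKernel, brjCoeff]
      field_simp
    rw [e, norm_mul, norm_div, Complex.norm_real, Real.norm_of_nonneg Real.pi_pos.le]
    calc ‖X‖ / Real.pi * _ ≤ ‖X‖ / 1 * (M * ‖X⁻¹‖ ^ 3) := by gcongr
      _ = M / ‖X‖ ^ 2 := by rw [norm_inv]; field_simp
  have hcoeff : ∀ l ∈ Set.Icc (0 : ℝ) 1, ‖brjCoeff l‖ ≤ M := by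
    intro l hl
    rw [brjCoeff, norm_div, norm_mul, Complex.norm_real, Real.norm_of_nonneg Real.pi_pos.le,
      Complex.norm_ofNat]
    exact (div_le_self (norm_nonneg _) (by linarith)).trans (h l hl).2.2.1
  refine ⟨30 * D + 10 * M, by positivity, fun l hl => ⟨by linarith [hcoeff l hl], ?_, ?_⟩⟩
  · intro X hX
    have hpos : 0 < ‖X‖ := norm_pos_iff.2 hX
    rcases le_or_gt 2 ‖X‖ with h2 | h2
    · have h3 := norm_add_le (brjKernel l X - brjCoeff l / X) (brjCoeff l / X)
      rw [sub_add_cancel, norm_div] at h3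
      have h4 : M / ‖X‖ ^ 2 ≤ M / ‖X‖ :=
        div_le_div_of_nonneg_left hM.le hpos (by nlinarith)
      have h5 : ‖brjCoeff l‖ / ‖X‖ ≤ M / ‖X‖ := by gcongr; exact hcoeff l hl
      have h6 : M / ‖X‖ + M / ‖X‖ ≤ (30 * D + 10 * M) / ‖X‖ := by
        rw [← add_div]; exact div_le_div_of_nonneg_right (by linarith) hpos.le
      linarith [hfar l hl X h2]
    · have h3 := norm_dilog_arg_le hD hdil hl hX h2.le
      have h4 : Real.sqrt (5 / ‖X‖) ≤ 5 / ‖X‖ := by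
        have h1 : 1 ≤ 5 / ‖X‖ := by rw [le_div_iff₀ hpos]; linarith
        rw [Real.sqrt_le_left (by positivity)]
        nlinarith
      have h5 : ‖(Real.pi : ℂ) * brjKernel l X‖ ≤ 3 * (D * (5 / ‖X‖)) + ‖X‖ * M + M := by
        rw [brjKernel_expansion l hX]
        refine (norm_add_le _ _).trans (add_le_add ((norm_sub_le _ _).trans (add_le_add ?_ ?_))
          (h l hl).2.1)
        · rw [norm_mul, norm_neg]
          refine mul_le_mul ?_ (h3.trans (by gcongr)) (norm_nonneg _) (by norm_num)
          refine (norm_add_le _ _).trans ?_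
          rw [norm_mul, norm_one, Complex.norm_real, Real.norm_of_nonneg hl.1]
          nlinarith [hl.2, hl.1]
        · rw [norm_mul]
          gcongr
          exact (h l hl).1
      rw [norm_mul, Complex.norm_real, Real.norm_of_nonneg Real.pi_pos.le] at h5
      have h6 : ‖brjKernel l X‖ ≤ Real.pi * ‖brjKernel l X‖ :=
        le_mul_of_one_le_left (norm_nonneg _) hpi
      refine h6.trans (h5.trans ?_)
      rw [le_div_iff₀ hpos]
      have : (3 * (D * (5 / ‖X‖)) + ‖X‖ * M + M) * ‖X‖ = 15 * D + M * ‖X‖ ^ 2 + M * ‖X‖ := by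
        field_simp
        ring
      rw [this]
      nlinarith [mul_pos hM hpos]
  · intro X hX
    refine (hfar l hl X hX).trans ?_
    gcongr
    linarith

@[simp] lemma brjKernel_zero_right (l : ℝ) : brjKernel l 0 = 0 := by simp [brjKernel]

lemma brjKernel_re {l : ℝ} {X : ℂ} (hX : X ≠ 0) :
    Real.pi * (brjKernel l X).re =
      -((1 + l * X) * dilog (-l - X⁻¹)).re - (X * mulDilog (-l)).re + (deriv mulDilog (-l)).re := by
  have := congrArg Complex.re (brjKernel_expansion l hX)
  rw [Complex.re_ofReal_mul] at this
  rw [this, neg_mul]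
  simp only [Complex.add_re, Complex.sub_re, Complex.neg_re]

lemma continuousAt_brjKernel_re (l : ℝ) {X₀ : ℂ} (hX : X₀ ≠ 0) :
    ContinuousAt (fun X => (brjKernel l X).re) X₀ := by
  have hpi : Real.pi ≠ 0 := Real.pi_ne_zero
  have hy : ContinuousAt (fun X : ℂ => -l - X⁻¹) X₀ :=
    continuousAt_const.sub (continuousAt_inv₀ hX)
  have hIm : ContinuousAt (fun X : ℂ => X.im * (dilog (-l - X⁻¹)).im) X₀ := by
    by_cases h : X₀.im = 0
    · obtain ⟨C, hC, hb⟩ := exists_norm_dilog_le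
      rw [ContinuousAt, h, zero_mul]
      have hlim : Tendsto (fun X : ℂ => |X.im| * (C * Real.sqrt (1 + ‖-l - X⁻¹‖))) (𝓝 X₀) (𝓝 0) := by
        have h1 : ContinuousAt (fun X : ℂ => |X.im|) X₀ :=
          (continuous_abs.comp Complex.continuous_im).continuousAt
        have h2 : ContinuousAt (fun X : ℂ => C * Real.sqrt (1 + ‖-l - X⁻¹‖)) X₀ :=
          continuousAt_const.mul (continuousAt_const.add hy.norm).sqrt
        have := (h1.mul h2).tendsto
        rw [Pi.mul_apply, h, abs_zero, zero_mul] at this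
        exact this
      refine squeeze_zero_norm (fun X => ?_) hlim
      rw [norm_mul, Real.norm_eq_abs]
      exact mul_le_mul_of_nonneg_left ((Complex.abs_im_le_norm _).trans (hb _)) (abs_nonneg _)
    · refine Complex.continuous_im.continuousAt.mul (Complex.continuous_im.continuousAt.comp ?_)
      refine ContinuousAt.comp (g := dilog) (hasDerivAt_dilog (mem_slitPlane_of_im_ne ?_)).continuousAt hy
      have : Complex.normSq X₀ ≠ 0 := by simpa using hX
      simp [Complex.inv_im, h, this]
  have hmain : ContinuousAt (fun X : ℂ => ((1 + l * X) * dilog (-l - X⁻¹)).re) X₀ := by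
    have : (fun X : ℂ => ((1 + l * X) * dilog (-l - X⁻¹)).re) = fun X =>
        (1 + l * X.re) * (dilog (-l - X⁻¹)).re - l * (X.im * (dilog (-l - X⁻¹)).im) := by
      ext X; simp [Complex.mul_re]; ring
    rw [this]
    refine ContinuousAt.sub (ContinuousAt.mul ?_ ?_) (hIm.const_mul _)
    · exact continuousAt_const.add (Complex.continuous_re.continuousAt.const_mul _)
    · exact ContinuousAt.comp (g := fun y => (dilog y).re) continuous_dilog_re.continuousAt hy
  have heq : (fun X => (brjKernel l X).re) =ᶠ[𝓝 X₀] fun X => Real.pi⁻¹ *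
      (-((1 + l * X) * dilog (-l - X⁻¹)).re - (X * mulDilog (-l)).re + (deriv mulDilog (-l)).re) := by
    filter_upwards [isOpen_ne.mem_nhds hX] with X hX'
    rw [← brjKernel_re hX', inv_mul_cancel_left₀ hpi]
  refine ContinuousAt.congr ?_ heq.symm
  refine ((hmain.neg.sub ?_).add continuousAt_const).const_mul _
  exact (Complex.continuous_re.comp (continuous_id.mul continuous_const)).continuousAt

/-- The antisymmetrised kernel, combining the two matrices with the same pole. -/
noncomputable def pairKernel (l : ℝ) (X : ℂ) : ℂ := brjKernel l X - brjKernel (1 - l) (-X)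

/-- The part of `pairKernel` that does not tend to a constant at the origin. -/
noncomputable def dilogGap (y : ℂ) : ℝ := (dilog y).re - (dilog (-1 - y)).re

/-- The constant term of `pairKernel` at the origin. -/
noncomputable def pairShift (l : ℝ) : ℝ :=
  (deriv mulDilog (-l)).re - (deriv mulDilog (-(1 - l : ℝ))).re

@[simp] lemma pairKernel_zero_right (l : ℝ) : pairKernel l 0 = 0 := by simp [pairKernel]

lemma continuousAt_pairKernel_re (l : ℝ) {X₀ : ℂ} (hX : X₀ ≠ 0) :
    ContinuousAt (fun X => (pairKernel l X).re) X₀ := by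
  have h2 : ContinuousAt (fun X => (brjKernel (1 - l) (-X)).re) X₀ :=
    ContinuousAt.comp (g := fun X => (brjKernel (1 - l) X).re)
      (continuousAt_brjKernel_re (1 - l) (neg_ne_zero.2 hX)) continuous_neg.continuousAt
  exact ((continuousAt_brjKernel_re l hX).sub h2).congr (.of_forall fun X => by simp [pairKernel])

lemma abs_log_sq_sub_le {y : ℂ} (hy : 2 ≤ ‖y‖) :
    |Real.log ‖y‖ ^ 2 - Real.log ‖1 + y‖ ^ 2| ≤ 10 / Real.sqrt ‖y‖ := by
  set r := ‖y‖ with hr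
  set s := ‖1 + y‖ with hs
  have hrs : |s - r| ≤ 1 := by
    have := abs_norm_sub_norm_le (1 + y) y
    simpa using this
  obtain ⟨h1, h2⟩ := abs_le.1 hrs
  have hr0 : 0 < r := by linarith
  have hs0 : 0 < s := by linarith
  set q := Real.sqrt r with hq
  have hqq : q * q = r := Real.mul_self_sqrt hr0.le
  have hq0 : 0 < q := Real.sqrt_pos.2 hr0
  have hq1 : 1 ≤ q := by nlinarith
  have hlr : Real.log r ≤ 2 * q := by
    have := Real.log_le_sub_one_of_pos hq0
    rw [hq, Real.log_sqrt hr0.le] at this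
    linarith
  have hd1 : Real.log s - Real.log r ≤ 1 / r := by
    rw [← Real.log_div hs0.ne' hr0.ne']
    refine (Real.log_le_sub_one_of_pos (by positivity)).trans ?_
    rw [div_sub_one hr0.ne']
    exact div_le_div_of_nonneg_right h2 hr0.le
  have hd2 : Real.log r - Real.log s ≤ 2 / r := by
    rw [← Real.log_div hr0.ne' hs0.ne']
    refine (Real.log_le_sub_one_of_pos (by positivity)).trans ?_
    rw [div_sub_one hs0.ne', div_le_div_iff₀ hs0 hr0]
    nlinarith
  have hlr0 : 0 ≤ Real.log r := Real.log_nonneg (by linarith)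
  have hls0 : 0 ≤ Real.log s := Real.log_nonneg (by linarith)
  have h1r : 1 / r ≤ 1 := by rw [div_le_one hr0]; linarith
  have e : Real.log r ^ 2 - Real.log s ^ 2 = (Real.log r - Real.log s) * (Real.log r + Real.log s) := by
    ring
  rw [e, abs_mul, abs_of_nonneg (add_nonneg hlr0 hls0)]
  have h12 : 1 / r ≤ 2 / r := by gcongr; norm_num
  have ha : |Real.log r - Real.log s| ≤ 2 / r := abs_le.2 ⟨by linarith, hd2⟩
  have hb : Real.log r + Real.log s ≤ 5 * q := by linarith
  calc |Real.log r - Real.log s| * (Real.log r + Real.log s) ≤ 2 / r * (5 * q) := by gcongr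
    _ = 10 / q := by rw [← hqq]; field_simp; norm_num

lemma exists_dilogGap_sub_le : ∃ C : ℝ, 0 < C ∧ ∀ y : ℂ, 2 ≤ ‖y‖ →
    |dilogGap y - (-(dilog y⁻¹).re + (dilog (-1 - y)⁻¹).re +
      (absArg (-y) ^ 2 - absArg (1 + y) ^ 2) / 2)| ≤ C / Real.sqrt ‖y‖ := by
  obtain ⟨c, hc⟩ := exists_dilog_re_inversion
  refine ⟨5, by norm_num, fun y hy => ?_⟩
  have hy0 : y ≠ 0 := by rintro rfl; norm_num at hy
  have hy1 : -1 - y ≠ 0 := by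
    intro h
    have : y = -1 := by linear_combination -h
    rw [this] at hy; norm_num at hy
  have e1 := hc y hy0
  have e2 := hc _ hy1
  have e3 : -(-1 - y) = 1 + y := by ring
  have e4 : ‖-1 - y‖ = ‖1 + y‖ := by rw [← norm_neg, e3]
  rw [e3, e4] at e2
  have : dilogGap y - (-(dilog y⁻¹).re + (dilog (-1 - y)⁻¹).re +
      (absArg (-y) ^ 2 - absArg (1 + y) ^ 2) / 2) =
      -((Real.log ‖y‖ ^ 2 - Real.log ‖1 + y‖ ^ 2) / 2) := by
    rw [dilogGap]; linarith
  rw [this, abs_neg, abs_div, abs_two]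
  have := abs_log_sq_sub_le hy
  calc _ ≤ 10 / Real.sqrt ‖y‖ / 2 := by gcongr
    _ = _ := by ring

lemma exists_abs_dilogGap_le : ∃ C : ℝ, 0 < C ∧ ∀ y : ℂ, |dilogGap y| ≤ C := by
  obtain ⟨D, hD, hdil⟩ := exists_norm_dilog_le
  obtain ⟨C, hC, h⟩ := exists_dilogGap_sub_le
  have hre : ∀ y : ℂ, ‖y‖ ≤ 3 → |(dilog y).re| ≤ 2 * D := fun y hy => by
    refine (Complex.abs_re_le_norm _).trans ((hdil y).trans ?_)
    have : Real.sqrt (1 + ‖y‖) ≤ 2 := by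
      rw [Real.sqrt_le_left (by norm_num)]; linarith
    nlinarith
  refine ⟨4 * D + C + 16, by positivity, fun y => ?_⟩
  rcases le_total ‖y‖ 2 with hy | hy
  · have h1 := abs_le.1 (hre y (by linarith))
    have h2 := abs_le.1 (hre (-1 - y) (by
      have := norm_sub_le (-1 : ℂ) y
      rw [norm_neg, norm_one] at this; linarith))
    rw [dilogGap, abs_le]
    constructor <;> linarith
  · have hinv : ∀ w : ℂ, 1 ≤ ‖w‖ → ‖w⁻¹‖ ≤ 3 := fun w hw => by
      rw [norm_inv]; exact (inv_le_one_of_one_le₀ hw).trans (by norm_num)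
    have h1 := abs_le.1 (hre _ (hinv y (by linarith)))
    have h2 := abs_le.1 (hre _ (hinv (-1 - y) (by
      have := norm_sub_norm_le (-y) 1
      rw [norm_neg, norm_one] at this
      rw [show -1 - y = -y - 1 by ring]
      linarith)))
    have h3 := h y hy
    have h4 : C / Real.sqrt ‖y‖ ≤ C := by
      refine div_le_self hC.le ?_
      rw [Real.one_le_sqrt]; linarith
    have h3 := abs_le.1 (h3.trans h4)
    have hpi := Real.pi_lt_four
    have a1 := absArg_nonneg (-y)
    have a2 := absArg_le_pi (-y)
    have a3 := absArg_nonneg (1 + y)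
    have a4 := absArg_le_pi (1 + y)
    have b1 : absArg (-y) ^ 2 ≤ 16 := by nlinarith
    have b2 : absArg (1 + y) ^ 2 ≤ 16 := by nlinarith
    have b3 := sq_nonneg (absArg (-y))
    have b4 := sq_nonneg (absArg (1 + y))
    rw [abs_le]
    constructor <;> linarith [h3.1, h3.2]

lemma exists_abs_pairKernel_sub_le : ∃ C : ℝ, 0 < C ∧ ∀ l ∈ Set.Icc (0 : ℝ) 1,
    |pairShift l| ≤ C ∧ ∀ X : ℂ, X ≠ 0 → ‖X‖ ≤ 1 →
      |Real.pi * (pairKernel l X).re + dilogGap (-l - X⁻¹) - pairShift l| ≤ C * Real.sqrt ‖X‖ := by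
  obtain ⟨M, hM, h⟩ := exists_mulDilog_taylor
  obtain ⟨D, hD, hdil⟩ := exists_norm_dilog_le
  refine ⟨6 * D + 2 * M, by positivity, fun l hl => ?_⟩
  have hl' : 1 - l ∈ Set.Icc (0 : ℝ) 1 := ⟨by linarith [hl.2], by linarith [hl.1]⟩
  refine ⟨?_, fun X hX hX1 => ?_⟩
  · have h1 := abs_le.1 ((Complex.abs_re_le_norm _).trans (h l hl).2.1)
    have h2 := abs_le.1 ((Complex.abs_re_le_norm _).trans (h _ hl').2.1)
    rw [pairShift, abs_le]
    constructor <;> linarith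
  · have hpos : 0 < ‖X‖ := norm_pos_iff.2 hX
    have e : (-(1 - l : ℝ) - (-X)⁻¹ : ℂ) = -1 - (-l - X⁻¹) := by
      rw [inv_neg]; push_cast; ring
    have k1 := norm_dilog_arg_le hD hdil hl hX (by linarith)
    have k2 := norm_dilog_arg_le hD hdil hl' (neg_ne_zero.2 hX) (by rw [norm_neg]; linarith)
    have r1 := brjKernel_re (l := l) hX
    have r2 := brjKernel_re (l := 1 - l) (neg_ne_zero.2 hX)
    rw [e] at k2 r2
    rw [norm_neg] at k2
    have key : Real.pi * (pairKernel l X).re + dilogGap (-l - X⁻¹) - pairShift l =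
        -(X * (l * dilog (-l - X⁻¹) + (1 - l : ℝ) * dilog (-1 - (-l - X⁻¹)) + mulDilog (-l) +
          mulDilog (-(1 - l : ℝ)))).re := by
      rw [pairKernel, Complex.sub_re, mul_sub, r1, r2, dilogGap, pairShift]
      simp only [add_mul, one_mul, Complex.add_re, neg_mul, mul_neg, mul_add, Complex.neg_re]
      rw [mul_left_comm, mul_assoc, mul_left_comm X, mul_assoc]
      ring
    rw [key, abs_neg]
    refine (Complex.abs_re_le_norm _).trans ?_
    rw [norm_mul]
    have hs : Real.sqrt (5 / ‖X‖) * ‖X‖ ≤ 3 * Real.sqrt ‖X‖ := by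
      rw [Real.sqrt_div (by norm_num)]
      have h5 : Real.sqrt 5 ≤ 3 := by rw [Real.sqrt_le_left (by norm_num)]; norm_num
      have := Real.mul_self_sqrt hpos.le
      have hp := Real.sqrt_pos.2 hpos
      rw [div_mul_eq_mul_div, div_le_iff₀ hp]
      nlinarith
    have hs2 : ‖X‖ ≤ Real.sqrt ‖X‖ := by
      exact Real.le_sqrt_of_sq_le (by nlinarith)
    have n1 : ‖(l * dilog (-l - X⁻¹) : ℂ)‖ ≤ D * Real.sqrt (5 / ‖X‖) := by
      rw [norm_mul, Complex.norm_real, Real.norm_of_nonneg hl.1]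
      exact (mul_le_of_le_one_left (norm_nonneg _) hl.2).trans k1
    have n2 : ‖((1 - l : ℝ) * dilog (-1 - (-l - X⁻¹)) : ℂ)‖ ≤ D * Real.sqrt (5 / ‖X‖) := by
      rw [norm_mul, Complex.norm_real, Real.norm_of_nonneg hl'.1]
      exact (mul_le_of_le_one_left (norm_nonneg _) hl'.2).trans k2
    have n3 := (h l hl).1
    have n4 := (h _ hl').1
    calc _ ≤ ‖X‖ * (D * Real.sqrt (5 / ‖X‖) + D * Real.sqrt (5 / ‖X‖) + M + M) := by
          refine mul_le_mul_of_nonneg_left ?_ hpos.le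
          refine (norm_add_le _ _).trans (add_le_add ((norm_add_le _ _).trans (add_le_add
            ((norm_add_le _ _).trans (add_le_add n1 n2)) n3)) n4)
      _ = 2 * D * (Real.sqrt (5 / ‖X‖) * ‖X‖) + 2 * M * ‖X‖ := by ring
      _ ≤ 2 * D * (3 * Real.sqrt ‖X‖) + 2 * M * Real.sqrt ‖X‖ := by gcongr
      _ = _ := by ring

lemma exists_abs_pairKernel_le : ∃ C : ℝ, 0 < C ∧ ∀ l ∈ Set.Icc (0 : ℝ) 1,
    |pairShift l| ≤ C ∧ ∀ X : ℂ, |(pairKernel l X).re| ≤ C / (1 + ‖X‖) := by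
  obtain ⟨C, hC, hk⟩ := exists_norm_brjKernel_sub_le
  obtain ⟨D, hD, hg⟩ := exists_abs_dilogGap_le
  obtain ⟨M, hM, hp⟩ := exists_abs_pairKernel_sub_le
  refine ⟨4 * C + 2 * D + 4 * M, by positivity, fun l hl => ⟨?_, fun X => ?_⟩⟩
  · linarith [(hp l hl).1]
  have hl' : 1 - l ∈ Set.Icc (0 : ℝ) 1 := ⟨by linarith [hl.2], by linarith [hl.1]⟩
  rcases eq_or_ne X 0 with rfl | hX
  · simp; positivity
  have hpos : 0 < ‖X‖ := norm_pos_iff.2 hX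
  rw [le_div_iff₀ (by positivity)]
  rcases le_total ‖X‖ 1 with h1 | h1
  · have h2 := (hp l hl).2 X hX h1
    have h3 := abs_le.1 (hg (-l - X⁻¹))
    have h4 := abs_le.1 (hp l hl).1
    have h5 : M * Real.sqrt ‖X‖ ≤ M * 1 := by
      gcongr; rw [Real.sqrt_le_one]; exact h1
    have h6 := abs_le.1 (h2.trans h5)
    have h7 : Real.pi * |(pairKernel l X).re| ≤ D + 2 * M := by
      have e : Real.pi * |(pairKernel l X).re| = |Real.pi * (pairKernel l X).re| := by
        rw [abs_mul, abs_of_pos Real.pi_pos]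
      rw [e, abs_le]
      constructor <;> linarith [h6.1, h6.2, h3.1, h3.2, h4.1, h4.2]
    have h8 : |(pairKernel l X).re| ≤ D + 2 * M := by
      have := abs_nonneg (pairKernel l X).re
      nlinarith [Real.pi_gt_three]
    nlinarith [abs_nonneg (pairKernel l X).re]
  · have h2 : |(pairKernel l X).re| ≤ C / ‖X‖ + C / ‖X‖ := by
      refine (Complex.abs_re_le_norm _).trans ((norm_sub_le _ _).trans (add_le_add
        ((hk l hl).2.1 X hX) ?_))
      simpa using (hk _ hl').2.1 (-X) (neg_ne_zero.2 hX)
    have h3 : |(pairKernel l X).re| * ‖X‖ ≤ 2 * C := by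
      rw [← le_div_iff₀ hpos, two_mul, add_div]; exact h2
    nlinarith [abs_nonneg (pairKernel l X).re]

lemma tendsto_dilogGap {ι : Type*} {F : Filter ι} {y : ι → ℂ} {ψ : ℝ}
    (hy : Tendsto (fun i => ‖y i‖) F atTop) (h1 : Tendsto (fun i => absArg (-y i)) F (𝓝 ψ))
    (h2 : Tendsto (fun i => absArg (1 + y i)) F (𝓝 (Real.pi - ψ))) :
    Tendsto (fun i => dilogGap (y i)) F (𝓝 (Real.pi * ψ - Real.pi ^ 2 / 2)) := by
  obtain ⟨C, hC, h⟩ := exists_dilogGap_sub_le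
  have hy2 : Tendsto y F (Bornology.cobounded ℂ) := tendsto_norm_atTop_iff_cobounded.1 hy
  have hi : Tendsto (fun i => (dilog (y i)⁻¹).re) F (𝓝 0) := by
    have := (continuous_dilog_re.tendsto 0).comp (tendsto_inv₀_cobounded.comp hy2)
    simpa [dilog_zero, Function.comp_def] using this
  have hj : Tendsto (fun i => (dilog (-1 - y i)⁻¹).re) F (𝓝 0) := by
    have hy3 : Tendsto (fun i => -1 - y i) F (Bornology.cobounded ℂ) := by
      refine tendsto_norm_atTop_iff_cobounded.1
        (tendsto_atTop_mono (fun i => ?_) (tendsto_atTop_add_const_right F (-1) hy))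
      have := norm_sub_norm_le (-y i) 1
      rw [norm_neg, norm_one] at this
      rw [show -1 - y i = -y i - 1 by ring]
      linarith
    have := (continuous_dilog_re.tendsto 0).comp (tendsto_inv₀_cobounded.comp hy3)
    simpa [dilog_zero, Function.comp_def] using this
  have hmain : Tendsto (fun i => -(dilog (y i)⁻¹).re + (dilog (-1 - y i)⁻¹).re +
      (absArg (-y i) ^ 2 - absArg (1 + y i) ^ 2) / 2) F (𝓝 (Real.pi * ψ - Real.pi ^ 2 / 2)) := by
    convert (hi.neg.add hj).add (((h1.pow 2).sub (h2.pow 2)).div_const 2) using 2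
    ring
  have herr : Tendsto (fun i => dilogGap (y i) - (-(dilog (y i)⁻¹).re + (dilog (-1 - y i)⁻¹).re +
      (absArg (-y i) ^ 2 - absArg (1 + y i) ^ 2) / 2)) F (𝓝 0) := by
    have hlim : Tendsto (fun i => C / Real.sqrt ‖y i‖) F (𝓝 0) :=
      (Real.tendsto_sqrt_atTop.comp hy).const_div_atTop C
    refine squeeze_zero_norm' ?_ hlim
    filter_upwards [hy.eventually_ge_atTop 2] with i hi using h _ hi
  have := herr.add hmain
  simpa using this

lemma tendsto_pairKernel_re {ι : Type*} {F : Filter ι} {X : ι → ℂ} {u : ℂ} {l : ℝ}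
    (hl : l ∈ Set.Icc (0 : ℝ) 1) (hX : Tendsto X F (𝓝 0)) (hX0 : ∀ᶠ i in F, X i ≠ 0)
    (hu : Tendsto (fun i => X i / ‖X i‖) F (𝓝 u)) (hu0 : u ≠ 0) :
    Tendsto (fun i => (pairKernel l (X i)).re) F
      (𝓝 (pairShift l / Real.pi + Real.pi / 2 - absArg u)) := by
  obtain ⟨M, hM, hp⟩ := exists_abs_pairKernel_sub_le
  have hn : Tendsto (fun i => ‖X i‖) F (𝓝 0) := by simpa using hX.norm
  have hnp : Tendsto (fun i => ‖X i‖) F (𝓝[>] 0) :=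
    tendsto_nhdsWithin_iff.2 ⟨hn, hX0.mono fun i hi => norm_pos_iff.2 hi⟩
  have hconj : Tendsto (fun i => (starRingEnd ℂ) (X i / ‖X i‖)) F (𝓝 ((starRingEnd ℂ) u)) :=
    (Complex.continuous_conj.tendsto u).comp hu
  have hu0' : (starRingEnd ℂ) u ≠ 0 := by simpa using hu0
  have hnC : Tendsto (fun i => (‖X i‖ : ℂ)) F (𝓝 0) := by
    have := (Complex.continuous_ofReal.tendsto 0).comp hn
    simpa [Function.comp_def] using this
  have hmul : ∀ x : ℂ, x ≠ 0 → ‖x‖ * x⁻¹ = (starRingEnd ℂ) (x / ‖x‖) := fun x hx => by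
    have h0 : (‖x‖ : ℂ) ≠ 0 := by exact_mod_cast norm_ne_zero_iff.2 hx
    rw [map_div₀, Complex.conj_ofReal, eq_div_iff h0, Complex.inv_def, Complex.normSq_eq_norm_sq]
    push_cast
    field_simp
  have harg : ∀ (c : ℂ) (s : ℂ), s = 1 ∨ s = -1 → Tendsto (fun i => absArg (c + s * (X i)⁻¹)) F
      (𝓝 (absArg (s * (starRingEnd ℂ) u))) := fun c s hs => by
    have hs0 : s ≠ 0 := by rcases hs with rfl | rfl <;> norm_num
    have h1 : Tendsto (fun i => ‖X i‖ * c + s * (starRingEnd ℂ) (X i / ‖X i‖)) F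
        (𝓝 (s * (starRingEnd ℂ) u)) := by
      simpa using (hnC.mul_const c).add (hconj.const_mul s)
    have h2 := (continuousAt_absArg (mul_ne_zero hs0 hu0')).tendsto.comp h1
    refine h2.congr' ?_
    filter_upwards [hX0] with i hi
    rw [Function.comp_apply, ← hmul _ hi, mul_left_comm, ← mul_add, absArg_smul (norm_pos_iff.2 hi)]
  have hy : Tendsto (fun i => ‖-l - (X i)⁻¹‖) F atTop := by
    refine tendsto_atTop_mono (fun i => ?_)
      (tendsto_atTop_add_const_right F (-1) (tendsto_inv_nhdsGT_zero.comp hnp))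
    have := norm_sub_norm_le (-(X i)⁻¹) (l : ℂ)
    rw [norm_neg, norm_inv, Complex.norm_real, Real.norm_of_nonneg hl.1] at this
    rw [show (-l - (X i)⁻¹ : ℂ) = -(X i)⁻¹ - l by ring]
    simp only [Function.comp_apply]
    linarith [hl.2]
  have hgap : Tendsto (fun i => dilogGap (-l - (X i)⁻¹)) F
      (𝓝 (Real.pi * absArg u - Real.pi ^ 2 / 2)) := by
    refine tendsto_dilogGap hy ?_ ?_
    · have := harg l 1 (Or.inl rfl)
      rw [one_mul, absArg_conj] at this
      refine this.congr fun i => ?_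
      congr 1; ring
    · have := harg (1 - l) (-1) (Or.inr rfl)
      rw [neg_one_mul, absArg_neg, absArg_conj] at this
      refine this.congr fun i => ?_
      congr 1; ring
  have herr : Tendsto (fun i => Real.pi * (pairKernel l (X i)).re + dilogGap (-l - (X i)⁻¹) -
      pairShift l) F (𝓝 0) := by
    have hlim : Tendsto (fun i => M * Real.sqrt ‖X i‖) F (𝓝 0) := by
      have := (Real.continuous_sqrt.tendsto 0).comp hn
      simpa [Function.comp_def] using this.const_mul M
    refine squeeze_zero_norm' ?_ hlim
    filter_upwards [hX0, hn.eventually_le_const zero_lt_one] with i h0 h1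
    exact (hp l hl).2 _ h0 h1
  have := ((herr.sub hgap).add_const (pairShift l)).div_const Real.pi
  have hpi : Real.pi ≠ 0 := Real.pi_ne_zero
  refine (this.congr fun i => ?_).trans (le_of_eq ?_)
  · field_simp; ring
  · congr 1; field_simp; ring

lemma Mmon_bounds {g : Matrix (Fin 2) (Fin 2) ℤ} (hg : g ∈ Mmon) :
    (g 0 0 * g 1 1 - g 0 1 * g 1 0 = 1 ∨ g 0 0 * g 1 1 - g 0 1 * g 1 0 = -1) ∧
      0 < g 1 1 ∧ (0 ≤ g 0 1 ∧ g 0 1 ≤ g 1 1) ∧ 0 ≤ g 1 0 ∧ g 1 0 ≤ g 1 1 := by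
  rcases hg with rfl | ⟨hdet, h1, h2, h3, h4, h5⟩
  · simp
  · refine ⟨hdet, ?_, ⟨by omega, h1⟩, by omega, h4⟩
    by_contra hd
    rw [show g 0 0 = 0 by omega, show g 0 1 = 0 by omega] at hdet
    omega

lemma Mmon_boundary {g : Matrix (Fin 2) (Fin 2) ℤ} (hg : g ∈ Mmon) :
    (g 0 1 = 0 → g 0 0 * g 1 1 - g 0 1 * g 1 0 = 1) ∧
    (g 0 1 = g 1 1 → g 0 0 * g 1 1 - g 0 1 * g 1 0 = -1) ∧
    (g 1 0 = 0 → g 0 0 * g 1 1 - g 0 1 * g 1 0 = 1) ∧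
    (g 1 0 = g 1 1 → g 0 0 * g 1 1 - g 0 1 * g 1 0 = -1) := by
  rcases hg with rfl | ⟨hdet, h1, h2, h3, h4, h5⟩
  · simp
  · have key : g 0 0 * g 1 1 - g 0 1 * g 1 0 = 1 → g 0 1 ≠ 0 ∧ g 0 1 ≠ g 1 1 ∧ g 1 0 ≠ 0 ∧
        g 1 0 ≠ g 1 1 := fun h => by
      refine ⟨fun h0 => ?_, fun h0 => ?_, fun h0 => ?_, fun h0 => ?_⟩ <;> rw [h0] at h <;> nlinarith
    have key' : g 0 0 * g 1 1 - g 0 1 * g 1 0 = -1 → g 0 1 ≠ 0 ∧ g 1 0 ≠ 0 := fun h => by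
      refine ⟨fun h0 => ?_, fun h0 => ?_⟩
      · rw [show g 0 0 = 0 by omega, h0] at h; omega
      · rw [show g 0 0 = 0 by omega, h0] at h; omega
    tauto

lemma Mmon_isCoprime {g : Matrix (Fin 2) (Fin 2) ℤ} (hg : g ∈ Mmon) (n : ℤ) :
    IsCoprime (n * g 1 1 + g 0 1) (g 1 1) := by
  have : IsCoprime (g 0 1) (g 1 1) := by
    rcases (Mmon_bounds hg).1 with h | h
    · exact ⟨-g 1 0, g 0 0, by linarith⟩
    · exact ⟨g 1 0, -g 0 0, by linarith⟩
  rw [add_comm]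
  exact this.add_mul_right_left n

lemma Int.eq_of_dvd_sub {d x y : ℤ} (h : d ∣ x - y) (hx : 0 ≤ x ∧ x ≤ d) (hy : 0 ≤ y ∧ y ≤ d)
    (h1 : ¬(x = d ∧ y = 0)) (h2 : ¬(x = 0 ∧ y = d)) : x = y := by
  by_contra hne
  have h3 := Int.le_of_dvd (a := d) (b := |x - y|) (abs_pos.2 (sub_ne_zero.2 hne)) ((dvd_abs _ _).2 h)
  rcases abs_cases (x - y) with h | h <;> omega

lemma Mmon_unique {g g' : Matrix (Fin 2) (Fin 2) ℤ} (hg : g ∈ Mmon) (hg' : g' ∈ Mmon) {n n' : ℤ}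
    (hd : g 1 1 = g' 1 1) (hn : n * g 1 1 + g 0 1 = n' * g' 1 1 + g' 0 1)
    (hdet : g 0 0 * g 1 1 - g 0 1 * g 1 0 = g' 0 0 * g' 1 1 - g' 0 1 * g' 1 0) :
    n = n' ∧ g = g' := by
  obtain ⟨e1, d1, b1, c1⟩ := Mmon_bounds hg
  obtain ⟨e2, d2, b2, c2⟩ := Mmon_bounds hg'
  obtain ⟨p1, p2, p3, p4⟩ := Mmon_boundary hg
  obtain ⟨q1, q2, q3, q4⟩ := Mmon_boundary hg'
  have hcop : IsCoprime (g 1 1) (g 0 1) := by simpa using (Mmon_isCoprime hg 0).symm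
  rw [← hd] at hn d2 b2 c2 q1 q2 q3 q4 e2 hdet
  have hc : g 1 0 = g' 1 0 := by
    refine Int.eq_of_dvd_sub (hcop.dvd_of_dvd_mul_left
      ⟨g 0 0 - g' 0 0 + (n - n') * g' 1 0, ?_⟩) c1 c2 ?_ ?_
    · have : g' 0 1 = g 0 1 + (n - n') * g 1 1 := by linarith
      rw [this] at hdet
      linear_combination -hdet
    · rintro ⟨h1, h2⟩; have := p4 h1; have := q3 h2; omega
    · rintro ⟨h1, h2⟩; have := p3 h1; have := q4 h2; omega
  have hb : g 0 1 = g' 0 1 := by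
    refine Int.eq_of_dvd_sub ⟨n' - n, by linear_combination hn⟩ b1 b2 ?_ ?_
    · rintro ⟨h1, h2⟩; have := p2 h1; have := q1 h2; omega
    · rintro ⟨h1, h2⟩; have := p1 h1; have := q2 h2; omega
  rw [hb] at hn
  have hn' : n = n' := mul_right_cancel₀ d1.ne' (add_right_cancel hn)
  have ha : g 0 0 = g' 0 0 := by
    rw [hb, hc] at hdet
    exact mul_right_cancel₀ d1.ne' (sub_left_inj.1 hdet)
  refine ⟨hn', ?_⟩
  ext i j
  fin_cases i <;> fin_cases j <;> assumption

lemma Mmon_complement {g g' : Matrix (Fin 2) (Fin 2) ℤ} (hg : g ∈ Mmon) (hg' : g' ∈ Mmon) {n n' : ℤ}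
    (hd : g 1 1 = g' 1 1) (hn : n * g 1 1 + g 0 1 = n' * g' 1 1 + g' 0 1)
    (h1 : g 0 0 * g 1 1 - g 0 1 * g 1 0 = 1) (h2 : g' 0 0 * g' 1 1 - g' 0 1 * g' 1 0 = -1) :
    g 1 0 + g' 1 0 = g 1 1 := by
  obtain ⟨-, d1, b1, c1⟩ := Mmon_bounds hg
  obtain ⟨-, d2, b2, c2⟩ := Mmon_bounds hg'
  obtain ⟨p1, p2, p3, p4⟩ := Mmon_boundary hg
  obtain ⟨q1, q2, q3, q4⟩ := Mmon_boundary hg'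
  have hcop : IsCoprime (g 1 1) (g 0 1) := by simpa using (Mmon_isCoprime hg 0).symm
  rw [← hd] at hn h2 q3 q4 c2
  have hdvd : g 1 1 ∣ g 1 0 + g' 1 0 := by
    refine hcop.dvd_of_dvd_mul_left ⟨g 0 0 + g' 0 0 - (n - n') * g' 1 0, ?_⟩
    have : g' 0 1 = g 0 1 + (n - n') * g 1 1 := by linarith
    rw [this] at h2
    linear_combination -h1 - h2
  have hpos : 0 < g' 1 0 := by
    rcases c2.1.lt_or_eq with h | h
    · exact h
    · have := q3 h.symm; omega
  have hlt : g 1 0 < g 1 1 := by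
    rcases c1.2.lt_or_eq with h | h
    · exact h
    · have := p4 h; omega
  have h3 : g 1 0 + g' 1 0 - g 1 1 = 0 := by
    have h4 : g 1 1 ∣ g 1 0 + g' 1 0 - g 1 1 := dvd_sub_self_right.2 hdvd
    by_contra hne
    have h5 := Int.le_of_dvd (abs_pos.2 hne) ((dvd_abs _ _).2 h4)
    rcases abs_cases (g 1 0 + g' 1 0 - g 1 1) with h | h <;> omega
  omega

/-- The rational pole of `z ↦ L_g φ (z - n)`. -/
def Mpole (x : ℤ × Mmon) : ℚ :=
  ((x.1 * x.2.1 1 1 + x.2.1 0 1 : ℤ) : ℚ) / ((x.2.1 1 1 : ℤ) : ℚ)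

lemma Mpole_den (x : ℤ × Mmon) : ((Mpole x).den : ℤ) = x.2.1 1 1 :=
  Rat.den_div_eq_of_coprime (Mmon_bounds x.2.2).2.1
    (Int.isCoprime_iff_gcd_eq_one.1 (Mmon_isCoprime x.2.2 x.1))

lemma Mpole_num (x : ℤ × Mmon) : (Mpole x).num = x.1 * x.2.1 1 1 + x.2.1 0 1 :=
  Rat.num_div_eq_of_coprime (Mmon_bounds x.2.2).2.1
    (Int.isCoprime_iff_gcd_eq_one.1 (Mmon_isCoprime x.2.2 x.1))

/-- The determinant of a matrix of `Mmon`. -/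
def Mdet (g : Matrix (Fin 2) (Fin 2) ℤ) : ℤ := g 0 0 * g 1 1 - g 0 1 * g 1 0

lemma Mpole_bijective :
    Function.Bijective fun x : ℤ × Mmon => (Mpole x, decide (Mdet x.2.1 = 1)) := by
  constructor
  · rintro ⟨n, g, hg⟩ ⟨n', g', hg'⟩ h
    obtain ⟨h1, h2⟩ := Prod.mk.inj h
    have hd := Mpole_den (n, ⟨g, hg⟩)
    have hn := Mpole_num (n, ⟨g, hg⟩)
    rw [h1] at hd hn
    have hd' := hd.symm.trans (Mpole_den _)
    have hn' := hn.symm.trans (Mpole_num _)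
    have hdet : Mdet g = Mdet g' := by
      have e1 := (Mmon_bounds hg).1
      have e2 := (Mmon_bounds hg').1
      rw [← Mdet] at e1 e2
      have h2' := decide_eq_decide.1 h2
      simp only at h2'
      omega
    obtain ⟨rfl, rfl⟩ := Mmon_unique hg hg' hd' hn' hdet
    rfl
  · rintro ⟨r, s⟩
    have hd : (0 : ℤ) < r.den := by exact_mod_cast r.den_pos
    obtain ⟨u, v, huv⟩ := Rat.isCoprime_num_den r
    suffices H : ∃ n : ℤ, ∃ g ∈ Mmon, g 1 1 = (r.den : ℤ) ∧ n * (r.den : ℤ) + g 0 1 = r.num ∧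
        Mdet g = if s then 1 else -1 by
      obtain ⟨n, g, hg, h1, h2, h3⟩ := H
      refine ⟨(n, ⟨g, hg⟩), Prod.ext ?_ ?_⟩
      · simp only [Mpole, h1, h2]
        exact_mod_cast r.num_div_den
      · simp only [h3]
        cases s <;> simp
    cases s
    · set c := (u - 1) % (r.den : ℤ) + 1 with hc
      set b := (r.num - 1) % (r.den : ℤ) + 1 with hb
      have hu := Int.emod_add_mul_ediv (u - 1) (r.den : ℤ)
      have hr := Int.emod_add_mul_ediv (r.num - 1) r.den
      have c1 := Int.emod_nonneg (u - 1) hd.ne'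
      have c2 := Int.emod_lt_of_pos (u - 1) hd
      have b1 := Int.emod_nonneg (r.num - 1) hd.ne'
      have b2 := Int.emod_lt_of_pos (r.num - 1) hd
      set m := (u - 1) / (r.den : ℤ)
      set n := (r.num - 1) / (r.den : ℤ)
      set d : ℤ := (r.den : ℤ) with hdd
      have hc' : c = u - d * m := by linarith
      have hb' : b = r.num - d * n := by linarith
      set a := -v - r.num * m - n * u + n * m * d with ha
      have hdet : a * d - b * c = -1 := by
        rw [hc', hb', ha]; linear_combination -huv
      have hc1 : 1 ≤ c := by omega
      have hb1 : 1 ≤ b := by omega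
      have hc2 : c ≤ d := by omega
      have hb2 : b ≤ d := by omega
      refine ⟨n, !![a, b; c, d], Or.inr ⟨Or.inr (by simpa using hdet), ?_, ?_, ?_, ?_, ?_⟩, ?_, ?_, ?_⟩
      · simpa using hb2
      · simp; nlinarith
      · simp; nlinarith
      · simpa using hc2
      · simp; nlinarith
      · simp
      · simp [hb']; ring
      · simpa [Mdet] using hdet
    · set c := (-u) % (r.den : ℤ) with hc
      set b := r.num % (r.den : ℤ) with hb
      have hu := Int.emod_add_mul_ediv (-u) r.den
      have hr := Int.emod_add_mul_ediv r.num r.den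
      have c1 := Int.emod_nonneg (-u) hd.ne'
      have c2 := Int.emod_lt_of_pos (-u) hd
      have b1 := Int.emod_nonneg r.num hd.ne'
      have b2 := Int.emod_lt_of_pos r.num hd
      set m := (-u) / (r.den : ℤ)
      set n := r.num / (r.den : ℤ)
      set d : ℤ := (r.den : ℤ) with hdd
      have hc' : c = -u - d * m := by linarith
      have hb' : b = r.num - d * n := by linarith
      set a := v - r.num * m + n * u + n * m * d with ha
      have hdet : a * d - b * c = 1 := by
        rw [hc', hb', ha]; linear_combination huv
      rw [← hc] at c1 c2
      rw [← hb] at b1 b2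
      refine ⟨n, !![a, b; c, d], ?_, by simp, by simp [hb']; ring, by simpa [Mdet] using hdet⟩
      rcases eq_or_ne d 1 with h1 | h1
      · left
        have h2 : c = 0 := by omega
        have h3 : b = 0 := by omega
        rw [h2, h3, h1] at hdet ⊢
        rw [show a = 1 by omega]
        exact Matrix.one_fin_two.symm
      · have hb1 : b ≠ 0 := fun h => h1 (by
          rw [h] at hdet
          exact Int.eq_one_of_mul_eq_one_left hd.le (by linarith : a * d = 1))
        have hc1 : c ≠ 0 := fun h => h1 (by
          rw [h] at hdet
          exact Int.eq_one_of_mul_eq_one_left hd.le (by linarith : a * d = 1))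
        have hb3 : 1 ≤ b := by omega
        have hc3 : 1 ≤ c := by omega
        right
        refine ⟨Or.inl (by simpa using hdet), ?_, ?_, ?_, ?_, ?_⟩
        · simpa using b2.le
        · simp; nlinarith
        · simp; nlinarith
        · simpa using c2.le
        · simp; nlinarith

/-- Matrices of `Mmon` up to integer translation are indexed by their pole and determinant. -/
noncomputable def MpoleEquiv : ℤ × Mmon ≃ ℚ × Bool := Equiv.ofBijective _ Mpole_bijective

/-- The ratio `c / d` of the lower entries of a matrix. -/
noncomputable def Mratio (g : Matrix (Fin 2) (Fin 2) ℤ) : ℝ := (g 1 0 : ℝ) / (g 1 1 : ℝ)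

lemma Mratio_mem {g : Matrix (Fin 2) (Fin 2) ℤ} (hg : g ∈ Mmon) :
    Mratio g ∈ Set.Icc (0 : ℝ) 1 := by
  obtain ⟨-, d1, -, c1, c2⟩ := Mmon_bounds hg
  have h : (0 : ℝ) < g 1 1 := by exact_mod_cast d1
  refine ⟨div_nonneg (by exact_mod_cast c1) h.le, ?_⟩
  rw [Mratio, div_le_one h]
  exact_mod_cast c2

lemma MpoleEquiv_symm_pole (r : ℚ) (s : Bool) : Mpole (MpoleEquiv.symm (r, s)) = r :=
  congrArg Prod.fst (MpoleEquiv.apply_symm_apply (r, s))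

lemma MpoleEquiv_symm_den (r : ℚ) (s : Bool) : (MpoleEquiv.symm (r, s)).2.1 1 1 = r.den := by
  rw [← Mpole_den, MpoleEquiv_symm_pole]

lemma MpoleEquiv_symm_det_true (r : ℚ) : Mdet (MpoleEquiv.symm (r, true)).2.1 = 1 := by
  have := congrArg Prod.snd (MpoleEquiv.apply_symm_apply (r, true))
  exact of_decide_eq_true this

lemma MpoleEquiv_symm_det_false (r : ℚ) : Mdet (MpoleEquiv.symm (r, false)).2.1 = -1 := by
  have := congrArg Prod.snd (MpoleEquiv.apply_symm_apply (r, false))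
  have h := of_decide_eq_false this
  exact (Mmon_bounds (MpoleEquiv.symm (r, false)).2.2).1.resolve_left h

lemma Mratio_symm_false (r : ℚ) : Mratio (MpoleEquiv.symm (r, false)).2.1 =
    1 - Mratio (MpoleEquiv.symm (r, true)).2.1 := by
  set x := MpoleEquiv.symm (r, true) with hx
  set y := MpoleEquiv.symm (r, false) with hy
  have hd : x.2.1 1 1 = y.2.1 1 1 := by rw [hx, hy, MpoleEquiv_symm_den, MpoleEquiv_symm_den]
  have hn : x.1 * x.2.1 1 1 + x.2.1 0 1 = y.1 * y.2.1 1 1 + y.2.1 0 1 := by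
    rw [← Mpole_num x, ← Mpole_num y, hx, hy, MpoleEquiv_symm_pole, MpoleEquiv_symm_pole]
  have := Mmon_complement x.2.2 y.2.2 hd hn (MpoleEquiv_symm_det_true r) (MpoleEquiv_symm_det_false r)
  have hpos : (y.2.1 1 1 : ℝ) ≠ 0 := by exact_mod_cast (Mmon_bounds y.2.2).2.1.ne'
  have h2 : (x.2.1 1 0 : ℝ) + y.2.1 1 0 = y.2.1 1 1 := by rw [hd] at this; exact_mod_cast this
  rw [Mratio, Mratio, hd, eq_sub_iff_add_eq, ← add_div, add_comm, h2, div_self hpos]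

lemma hasDerivAt_phi0_neg_inv {t : ℝ} (ht : 0 < t) :
    HasDerivAt phi0 ((Real.pi : ℂ)⁻¹ * (t : ℂ) ^ 2 * dilogDeriv (-t)) (-t : ℂ)⁻¹ := by
  have ht0 : (t : ℂ) ≠ 0 := by exact_mod_cast ht.ne'
  have h0 : (-t : ℂ)⁻¹ ≠ 0 := inv_ne_zero (neg_ne_zero.2 ht0)
  have hs : 1 - ((-t : ℂ)⁻¹)⁻¹ ∈ slitPlane := Or.inl (by simp; linarith)
  have := ((hasDerivAt_dilog hs).comp _ (hasDerivAt_inv h0)).const_mul (-(Real.pi : ℂ)⁻¹)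
  refine this.congr_deriv ?_
  rw [inv_inv]
  field_simp

lemma deriv_mulDilog_neg {l : ℝ} (hl : 0 ≤ l) :
    deriv mulDilog (-l) = dilog (-l) - l * dilogDeriv (-l) := by
  have hs : 1 - (-l : ℂ) ∈ slitPlane := Or.inl (by simp; linarith)
  have := ((hasDerivAt_id (-l : ℂ)).mul (hasDerivAt_dilog hs)).deriv
  have e : mulDilog = id * dilog := rfl
  rw [e, this]; simp; ring

lemma Lop_phi0_eq {g : Matrix (Fin 2) (Fin 2) ℤ} (hg : g ∈ Mmon) {w : ℂ}
    (hw : (g 0 1 : ℂ) - g 1 1 * w ≠ 0) :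
    Lop g phi0 w = (Mdet g : ℂ) / g 1 1 *
      brjKernel (Mratio g) (Mdet g * g 1 1 * (g 0 1 - g 1 1 * w)) := by
  have hpi : (Real.pi : ℂ) ≠ 0 := by exact_mod_cast Real.pi_ne_zero
  by_cases h1 : g = 1
  · subst h1
    have hw0 : w ≠ 0 := by simpa using hw
    have hm : deriv mulDilog 0 = 0 := by
      have := deriv_mulDilog_neg le_rfl
      simpa [dilog_zero] using this
    simp [Lop, Mdet, Mratio, brjKernel, hm, mulDilog, phi0]
    field_simp
  · have hM := hg.resolve_left h1
    obtain ⟨hdet, hd, -, hc, -⟩ := Mmon_bounds hg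
    have hc0 : g 1 0 ≠ 0 := fun h => by
      have h00 : g 0 0 = 0 := by omega
      rw [h, h00] at hdet; omega
    have hcC : (g 1 0 : ℂ) ≠ 0 := by exact_mod_cast hc0
    have hdC : (g 1 1 : ℂ) ≠ 0 := by exact_mod_cast hd.ne'
    have hlpos : 0 < Mratio g := div_pos (by exact_mod_cast lt_of_le_of_ne hc hc0.symm)
      (by exact_mod_cast hd)
    have hlC : ((Mratio g : ℝ) : ℂ) = g 1 0 / g 1 1 := by simp [Mratio]
    have hdetC : (Mdet g : ℂ) * Mdet g = 1 := by
      have : Mdet g * Mdet g = 1 := by rcases hdet with h | h <;> rw [Mdet, h] <;> norm_num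
      exact_mod_cast this
    have hdet0 : (Mdet g : ℂ) ≠ 0 := left_ne_zero_of_mul_eq_one hdetC
    have hdetE : (Mdet g : ℂ) = g 0 0 * g 1 1 - g 0 1 * g 1 0 := by simp [Mdet]
    have hinv : -(g 1 1 : ℂ) / g 1 0 = (-(Mratio g : ℝ) : ℂ)⁻¹ := by
      rw [hlC]; field_simp
    have hX : (Mdet g * g 1 1 * (g 0 1 - g 1 1 * w) : ℂ) ≠ 0 :=
      mul_ne_zero (mul_ne_zero hdet0 hdC) hw
    set X : ℂ := Mdet g * g 1 1 * (g 0 1 - g 1 1 * w) with hXd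
    have hXi : X⁻¹ = Mdet g / (g 1 1 * (g 0 1 - g 1 1 * w)) := by
      rw [inv_eq_iff_eq_inv, inv_div, eq_div_iff hdet0, hXd]
      linear_combination (g 1 1 * (g 0 1 - g 1 1 * w) : ℂ) * hdetC
    have hw' : (g 1 1 : ℂ) * w - g 0 1 ≠ 0 := by rw [← neg_ne_zero]; simpa using hw
    have hy : (((g 1 1 : ℂ) * w - g 0 1) / (g 0 0 - g 1 0 * w))⁻¹ = -(Mratio g : ℝ) - X⁻¹ := by
      rw [inv_div, hXi, hlC, hdetE, div_eq_iff hw', ← neg_sub (g 0 1 : ℂ)]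
      generalize hP : (g 0 1 : ℂ) - g 1 1 * w = P at hw
      field_simp
      linear_combination g 1 0 * hP
    have ha : (g 0 0 : ℂ) - g 1 0 * w = -(Mdet g / g 1 1) * X * (-(Mratio g : ℝ) - X⁻¹) := by
      rw [← hy, inv_div, hXd, mul_div_assoc', eq_div_iff hw']
      field_simp
      linear_combination (g 0 0 - g 1 0 * w : ℂ) * (g 0 1 - g 1 1 * w : ℂ) * hdetC
    have hdef : Lop g phi0 w = ((g 0 0 : ℂ) - g 1 0 * w) *
        (phi0 ((g 1 1 * w - g 0 1) / (g 0 0 - g 1 0 * w)) - phi0 (-(g 1 1 : ℂ) / g 1 0)) -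
        Mdet g * (g 1 0 : ℂ)⁻¹ * deriv phi0 (-(g 1 1 : ℂ) / g 1 0) := by
      rw [Lop, if_neg h1]; rfl
    rw [hdef, hinv, (hasDerivAt_phi0_neg_inv hlpos).deriv, phi0, phi0, hy, inv_inv, ha, brjKernel,
      deriv_mulDilog_neg hlpos.le, mulDilog, mulDilog]
    have hcc : (g 1 0 : ℂ)⁻¹ * (Mratio g : ℝ) ^ 2 = (Mratio g : ℝ) / g 1 1 := by
      rw [hlC]; field_simp
    have e : (Mdet g : ℂ) * (g 1 0 : ℂ)⁻¹ * ((Real.pi : ℂ)⁻¹ * (Mratio g : ℝ) ^ 2 *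
        dilogDeriv (-(Mratio g : ℝ))) = Mdet g * (Real.pi : ℂ)⁻¹ * dilogDeriv (-(Mratio g : ℝ)) *
        ((Mratio g : ℝ) / g 1 1) := by rw [← hcc]; ring
    rw [e]
    field_simp
    ring

lemma summable_Mmon_inv_cube : Summable fun g : Mmon => ((g.1 1 1 : ℝ) ^ 3)⁻¹ := by
  set f : ℤ → ℝ := fun n => 1 / |(n : ℝ) + (1 / 2 : ℝ)| ^ (3 / 2 : ℝ) with hf
  have hfs : Summable f := (Real.summable_one_div_int_add_rpow _ _).2 (by norm_num)
  have hf0 : ∀ n, 0 ≤ f n := fun n => by rw [hf]; positivity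
  have hlow : ∀ n d : ℤ, 0 ≤ n → n ≤ d → 0 < d → ((d : ℝ) ^ (3 / 2 : ℝ))⁻¹ ≤ 2 ^ (3 / 2 : ℝ) * f n := by
    intro n d h0 h1 h2
    have h0' : (0 : ℝ) ≤ n := by exact_mod_cast h0
    have h1' : (n : ℝ) ≤ d := by exact_mod_cast h1
    have h2' : (1 : ℝ) ≤ d := by exact_mod_cast h2
    rw [hf]
    simp only
    rw [abs_of_pos (by linarith), mul_one_div, ← Real.div_rpow (by norm_num) (by linarith),
      ← Real.inv_rpow (by linarith)]
    refine Real.rpow_le_rpow (by positivity) ?_ (by norm_num)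
    rw [inv_le_iff_one_le_mul₀ (by linarith), div_mul_eq_mul_div, le_div_iff₀ (by linarith)]
    linarith
  have hsum := (hfs.mul_of_nonneg (hfs.mul_of_nonneg hfs hf0 hf0) hf0
    (fun p => mul_nonneg (hf0 _) (hf0 _)))
  set K : ℝ := 2 ^ (3 / 2 : ℝ) with hK
  have hK0 : 0 < K := by positivity
  set m : ℝ := min (f 1) (f (-1)) with hm
  have hm0 : 0 < m := by
    refine lt_min ?_ ?_
    · simp only [hf]; norm_num; positivity
    · simp only [hf]; norm_num; positivity
  let φ : Mmon → ℤ × ℤ × ℤ := fun g => (Mdet g.1, g.1 0 1, g.1 1 1)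
  have hφ : Function.Injective φ := by
    rintro ⟨g, hg⟩ ⟨g', hg'⟩ h
    simp only [φ, Prod.mk.injEq] at h
    obtain ⟨h1, h2, h3⟩ := h
    exact Subtype.ext (Mmon_unique (n := 0) (n' := 0) hg hg' h3 (by simpa using h2) h1).2
  refine Summable.of_nonneg_of_le (fun g => ?_) (fun g => ?_)
    (((hsum.comp_injective hφ).mul_left (K ^ 2 / m)))
  · have := (Mmon_bounds g.2).2.1
    have : (0 : ℝ) < g.1 1 1 := by exact_mod_cast this
    positivity
  · obtain ⟨he, hd, hb, -⟩ := Mmon_bounds g.2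
    have hd' : (0 : ℝ) < g.1 1 1 := by exact_mod_cast hd
    have l1 := hlow _ _ hb.1 hb.2 hd
    have l2 := hlow _ _ hd.le le_rfl hd
    have l3 : m ≤ f (Mdet g.1) := by
      rcases he with h | h <;> rw [Mdet, h]
      · exact min_le_left _ _
      · exact min_le_right _ _
    have e : ((g.1 1 1 : ℝ) ^ 3)⁻¹ = ((g.1 1 1 : ℝ) ^ (3 / 2 : ℝ))⁻¹ * ((g.1 1 1 : ℝ) ^ (3 / 2 : ℝ))⁻¹ := by
      rw [← mul_inv, ← Real.rpow_add hd']; norm_num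
    rw [e]
    calc _ ≤ (K * f (g.1 0 1)) * (K * f (g.1 1 1)) :=
          mul_le_mul l1 l2 (by positivity) (mul_nonneg hK0.le (hf0 _))
      _ = K ^ 2 / m * (m * (f (g.1 0 1) * f (g.1 1 1))) := by field_simp
      _ ≤ _ := by
          refine mul_le_mul_of_nonneg_left (mul_le_mul_of_nonneg_right l3
            (mul_nonneg (hf0 _) (hf0 _))) (by positivity)

/-- The coefficient of `1 / w` in `L_g φ₀ w` at infinity. -/
noncomputable def Mcoeff (g : Matrix (Fin 2) (Fin 2) ℤ) : ℂ :=
  -brjCoeff (Mratio g) / (g 1 1 : ℂ) ^ 3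

/-- The function `L_g φ₀`, extended to the segment by its closed form. -/
noncomputable def Mker (g : Matrix (Fin 2) (Fin 2) ℤ) (w : ℂ) : ℂ :=
  (Mdet g : ℂ) / g 1 1 * brjKernel (Mratio g) (Mdet g * g 1 1 * (g 0 1 - g 1 1 * w))

lemma Lop_phi0_eq_Mker {g : Matrix (Fin 2) (Fin 2) ℤ} (hg : g ∈ Mmon) {w : ℂ} (hw : 0 < w.im) :
    Lop g phi0 w = Mker g w := by
  refine Lop_phi0_eq hg fun h => ?_
  have := congrArg Complex.im h
  have hd : (g 1 1 : ℝ) ≠ 0 := by exact_mod_cast (Mmon_bounds hg).2.1.ne'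
  simp [hw.ne', hd] at this

lemma norm_Mdet {g : Matrix (Fin 2) (Fin 2) ℤ} (hg : g ∈ Mmon) : ‖(Mdet g : ℂ)‖ = 1 := by
  rcases (Mmon_bounds hg).1 with h | h <;> rw [Mdet, h] <;> simp

lemma exists_norm_Mker_le : ∃ C : ℝ, 0 < C ∧ ∀ g ∈ Mmon,
    ‖Mcoeff g‖ ≤ C * ((g 1 1 : ℝ) ^ 3)⁻¹ ∧
    (∀ w : ℂ, 0 < w.im → ‖Mker g w‖ ≤ C * ((g 1 1 : ℝ) ^ 3)⁻¹ / w.im) ∧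
    ∀ w : ℂ, 4 ≤ ‖w‖ → ‖Mker g w - Mcoeff g / w‖ ≤ C * ((g 1 1 : ℝ) ^ 3)⁻¹ / ‖w‖ ^ 2 := by
  obtain ⟨C, hC, hk⟩ := exists_norm_brjKernel_sub_le
  refine ⟨4 * C, by positivity, fun g hg => ?_⟩
  obtain ⟨hc, hn, hf⟩ := hk _ (Mratio_mem hg)
  obtain ⟨-, hd, hb, -⟩ := Mmon_bounds hg
  have hd1 : (1 : ℝ) ≤ g 1 1 := by exact_mod_cast hd
  have hb0 : (0 : ℝ) ≤ g 0 1 := by exact_mod_cast hb.1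
  have hb1 : (g 0 1 : ℝ) ≤ g 1 1 := by exact_mod_cast hb.2
  have hnd : ‖(g 1 1 : ℂ)‖ = g 1 1 := by
    rw [Complex.norm_intCast, abs_of_nonneg (by linarith)]
  have hnb : ‖(g 0 1 : ℂ)‖ = g 0 1 := by
    rw [Complex.norm_intCast, abs_of_nonneg hb0]
  have hdC : (g 1 1 : ℂ) ≠ 0 := by exact_mod_cast hd.ne'
  have hbC : ((g 1 1 : ℝ) : ℂ) = g 1 1 := by simp
  have hdet := norm_Mdet hg
  have hdet0 : (Mdet g : ℂ) ≠ 0 := norm_ne_zero_iff.1 (by rw [hdet]; norm_num)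
  set d : ℝ := (g 1 1 : ℝ) with hdd
  have hd0 : 0 < d := by linarith
  have hmc : ‖Mcoeff g‖ ≤ C * (d ^ 3)⁻¹ := by
    rw [Mcoeff, norm_div, norm_neg, norm_pow, hnd, div_eq_mul_inv]
    gcongr
  have hnX : ∀ w : ℂ, ‖(Mdet g * g 1 1 * (g 0 1 - g 1 1 * w) : ℂ)‖ = d * ‖(g 0 1 - g 1 1 * w : ℂ)‖ := by
    intro w; rw [norm_mul, norm_mul, hdet, hnd, one_mul]
  refine ⟨hmc.trans ?_, fun w hw => ?_, fun w hw => ?_⟩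
  · gcongr; linarith
  · have h1 : d * w.im ≤ ‖(g 0 1 - g 1 1 * w : ℂ)‖ := by
      refine le_trans (le_of_eq ?_) (Complex.abs_im_le_norm _)
      simp [abs_mul, abs_of_pos hw]
      exact Or.inl (abs_of_pos hd0).symm
    have h1' : 0 < ‖(g 0 1 - g 1 1 * w : ℂ)‖ := lt_of_lt_of_le (by positivity) h1
    have h2 : (Mdet g * g 1 1 * (g 0 1 - g 1 1 * w) : ℂ) ≠ 0 := by
      rw [← norm_pos_iff, hnX]; positivity
    have h3 := hn _ h2
    rw [hnX] at h3
    rw [Mker, norm_mul, norm_div, hdet, hnd]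
    calc 1 / d * _ ≤ 1 / d * (C / (d * (d * w.im))) := by
          refine mul_le_mul_of_nonneg_left (h3.trans ?_) (by positivity)
          gcongr
      _ = C * (d ^ 3)⁻¹ / w.im := by field_simp
      _ ≤ _ := by gcongr; linarith
  · have hw0 : 0 < ‖w‖ := by linarith
    have hwC : w ≠ 0 := norm_pos_iff.1 hw0
    have h1 : 3 / 4 * (d * ‖w‖) ≤ ‖(g 0 1 - g 1 1 * w : ℂ)‖ := by
      have := norm_sub_norm_le (g 1 1 * w : ℂ) (g 0 1)
      rw [norm_sub_rev, norm_mul, hnd, hnb] at this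
      nlinarith
    have h1' : 0 < ‖(g 0 1 - g 1 1 * w : ℂ)‖ := lt_of_lt_of_le (by positivity) h1
    have hP : (g 0 1 - g 1 1 * w : ℂ) ≠ 0 := norm_pos_iff.1 h1'
    have h2 : 2 ≤ ‖(Mdet g * g 1 1 * (g 0 1 - g 1 1 * w) : ℂ)‖ := by
      rw [hnX]
      have : 3 ≤ ‖(g 0 1 - g 1 1 * w : ℂ)‖ := by nlinarith
      nlinarith
    have h3 := hf _ h2
    rw [hnX] at h3
    have e : Mker g w - Mcoeff g / w = (Mdet g : ℂ) / g 1 1 *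
        (brjKernel (Mratio g) (Mdet g * g 1 1 * (g 0 1 - g 1 1 * w)) -
          brjCoeff (Mratio g) / (Mdet g * g 1 1 * (g 0 1 - g 1 1 * w))) -
        Mcoeff g * (g 0 1 / ((g 0 1 - g 1 1 * w) * w)) := by
      rw [Mker, Mcoeff]
      generalize hQ : (g 0 1 : ℂ) - g 1 1 * w = P at hP
      field_simp
      linear_combination (-brjCoeff (Mratio g)) * hQ
    rw [e]
    refine (norm_sub_le _ _).trans ?_
    have t1 : ‖(Mdet g : ℂ) / g 1 1 *
        (brjKernel (Mratio g) (Mdet g * g 1 1 * (g 0 1 - g 1 1 * w)) -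
          brjCoeff (Mratio g) / (Mdet g * g 1 1 * (g 0 1 - g 1 1 * w)))‖ ≤
        2 * (C * (d ^ 3)⁻¹ / ‖w‖ ^ 2) := by
      rw [norm_mul, norm_div, hdet, hnd]
      calc 1 / d * _ ≤ 1 / d * (C / (d * (3 / 4 * (d * ‖w‖))) ^ 2) := by
            refine mul_le_mul_of_nonneg_left (h3.trans ?_) (by positivity)
            gcongr
        _ = 16 / 9 * (C * (d ^ 3)⁻¹ / ‖w‖ ^ 2) * (d ^ 2)⁻¹ := by field_simp; norm_num
        _ ≤ 16 / 9 * (C * (d ^ 3)⁻¹ / ‖w‖ ^ 2) * 1 := by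
            gcongr
            exact inv_le_one_of_one_le₀ (one_le_pow₀ hd1)
        _ ≤ _ := by
            have : 0 ≤ C * (d ^ 3)⁻¹ / ‖w‖ ^ 2 := by positivity
            linarith
    have t2 : ‖Mcoeff g * (g 0 1 / ((g 0 1 - g 1 1 * w) * w))‖ ≤ 2 * (C * (d ^ 3)⁻¹ / ‖w‖ ^ 2) := by
      rw [norm_mul, norm_div, norm_mul, hnb]
      calc _ ≤ (C * (d ^ 3)⁻¹) * (d / (3 / 4 * (d * ‖w‖) * ‖w‖)) := by gcongr
        _ = 4 / 3 * (C * (d ^ 3)⁻¹ / ‖w‖ ^ 2) := by field_simp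
        _ ≤ _ := by
            have : 0 ≤ C * (d ^ 3)⁻¹ / ‖w‖ ^ 2 := by positivity
            linarith
    linarith [show 4 * C * (d ^ 3)⁻¹ / ‖w‖ ^ 2 = 2 * (C * (d ^ 3)⁻¹ / ‖w‖ ^ 2) +
      2 * (C * (d ^ 3)⁻¹ / ‖w‖ ^ 2) by ring]

/-- The coefficient of `1 / z` of `Σ_ℳ φ₀` at infinity. -/
noncomputable def McoeffSum : ℂ := ∑' g : Mmon, Mcoeff g.1

lemma summable_Mcoeff : Summable fun g : Mmon => Mcoeff g.1 := by
  obtain ⟨C, hC, h⟩ := exists_norm_Mker_le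
  exact Summable.of_norm_bounded (summable_Mmon_inv_cube.mul_left C) fun g => (h _ g.2).1

lemma summable_Lop {w : ℂ} (hw : 0 < w.im) : Summable fun g : Mmon => Lop g.1 phi0 w := by
  obtain ⟨C, hC, h⟩ := exists_norm_Mker_le
  refine Summable.of_norm_bounded ((summable_Mmon_inv_cube.mul_left C).div_const w.im) fun g => ?_
  rw [Lop_phi0_eq_Mker g.2 hw]
  exact (h _ g.2).2.1 w hw

lemma a0_eq : a0 = McoeffSum := by
  obtain ⟨C, hC, h⟩ := exists_norm_Mker_le
  refine Tendsto.limUnder_eq ?_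
  set S := ∑' g : Mmon, C * ((g.1 1 1 : ℝ) ^ 3)⁻¹ with hS
  have hb : ∀ y : ℝ, 4 ≤ y →
      ‖Complex.I * y * sumM phi0 (Complex.I * y) - McoeffSum‖ ≤ S / y := by
    intro y hy
    have hy0 : 0 < y := by linarith
    have hw : 0 < (Complex.I * y).im := by simpa using hy0
    have hn : ‖Complex.I * y‖ = y := by simp [abs_of_pos hy0]
    have hw0 : Complex.I * y ≠ 0 := norm_pos_iff.1 (by rw [hn]; exact hy0)
    rw [sumM, McoeffSum, ← tsum_mul_left, ← ((summable_Lop hw).mul_left _).tsum_sub summable_Mcoeff]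
    refine tsum_of_norm_bounded ((summable_Mmon_inv_cube.mul_left C).hasSum.div_const y) fun g => ?_
    rw [Lop_phi0_eq_Mker g.2 hw]
    have := (h _ g.2).2.2 (Complex.I * y) (by rw [hn]; exact hy)
    rw [hn] at this
    have e : Complex.I * y * Mker g.1 (Complex.I * y) - Mcoeff g.1 =
        Complex.I * y * (Mker g.1 (Complex.I * y) - Mcoeff g.1 / (Complex.I * y)) := by
      rw [mul_sub, mul_div_cancel₀ _ hw0]
    rw [e, norm_mul, hn]
    calc y * _ ≤ y * (C * ((g.1 1 1 : ℝ) ^ 3)⁻¹ / y ^ 2) := by gcongr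
      _ = _ := by field_simp
  rw [tendsto_iff_norm_sub_tendsto_zero]
  refine squeeze_zero' (.of_forall fun _ => norm_nonneg _) ?_
    (tendsto_const_nhds.div_atTop tendsto_id : Tendsto (fun y : ℝ => S / y) atTop (𝓝 0))
  filter_upwards [eventually_ge_atTop 4] with y hy using hb y hy

/-- The odd function `n ↦ -1 / n` of `n`. -/
noncomputable def negInv (n : ℤ) : ℂ := -(n : ℂ)⁻¹

lemma summable_inv_sq_add_one : Summable fun n : ℤ => ((n : ℝ) ^ 2 + 1)⁻¹ := by
  have h := (Real.summable_one_div_int_add_rpow (1 / 2) 2).2 (by norm_num)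
  refine Summable.of_nonneg_of_le (fun n => by positivity) (fun n => ?_) (h.mul_left 2)
  rw [mul_one_div, Real.rpow_two, sq_abs]
  have h0 : (n : ℝ) + 1 / 2 ≠ 0 := by
    intro h0
    have : (2 * n + 1 : ℝ) = 0 := by linarith
    have : (2 * n + 1 : ℤ) = 0 := by exact_mod_cast this
    omega
  rw [inv_eq_one_div, div_le_div_iff₀ (by positivity) (by positivity)]
  nlinarith [sq_nonneg ((n : ℝ) - 1 / 2)]

lemma norm_negInv_le (n : ℤ) : ‖negInv n‖ ≤ 1 := by
  rw [negInv, norm_neg, norm_inv, Complex.norm_intCast]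
  rcases eq_or_ne n 0 with rfl | hn
  · simp
  · refine inv_le_one_of_one_le₀ ?_
    exact_mod_cast Int.one_le_abs hn

lemma norm_inv_sub_negInv_le {ρ : ℝ} {z : ℂ} (hz : ‖z‖ ≤ ρ) {n : ℤ}
    (hn : 2 * ρ + 8 ≤ |(n : ℝ)|) : |(n : ℝ)| / 2 + 4 ≤ ‖z - n‖ ∧
      ‖(z - n)⁻¹ - negInv n‖ ≤ 4 * ρ * ((n : ℝ) ^ 2 + 1)⁻¹ := by
  have hρ : 0 ≤ ρ := (norm_nonneg z).trans hz
  have h1 : |(n : ℝ)| / 2 + 4 ≤ ‖z - n‖ := by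
    have := norm_sub_norm_le (n : ℂ) z
    rw [norm_sub_rev, Complex.norm_intCast] at this
    linarith
  refine ⟨h1, ?_⟩
  have hpos : 0 < |(n : ℝ)| := by linarith
  have hn0 : (n : ℂ) ≠ 0 := by
    have : (n : ℝ) ≠ 0 := abs_pos.1 hpos
    exact_mod_cast this
  have hz0 : z - n ≠ 0 := norm_pos_iff.1 (by linarith)
  have e : (z - n)⁻¹ - negInv n = z / ((z - n) * n) := by
    rw [negInv]; field_simp; ring
  rw [e, norm_div, norm_mul, Complex.norm_intCast, ← sq_abs (n : ℝ), ← div_eq_mul_inv,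
    div_le_div_iff₀ (by positivity) (by positivity)]
  have h2 : |(n : ℝ)| ^ 2 + 1 ≤ 4 * (‖z - n‖ * |(n : ℝ)|) := by nlinarith
  calc ‖z‖ * (|(n : ℝ)| ^ 2 + 1) ≤ ρ * (4 * (‖z - n‖ * |(n : ℝ)|)) := by gcongr
    _ = _ := by ring

lemma exists_norm_Mker_sub_negInv_le : ∃ C : ℝ, 0 < C ∧ ∀ g ∈ Mmon, ∀ ρ : ℝ, ∀ z : ℂ, ‖z‖ ≤ ρ →
    ∀ n : ℤ, 2 * ρ + 8 ≤ |(n : ℝ)| → ‖Mker g (z - n) - Mcoeff g * negInv n‖ ≤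
      C * (1 + ρ) * (((g 1 1 : ℝ) ^ 3)⁻¹ * ((n : ℝ) ^ 2 + 1)⁻¹) := by
  obtain ⟨C, hC, h⟩ := exists_norm_Mker_le
  refine ⟨4 * C, by positivity, fun g hg ρ z hz n hn => ?_⟩
  have hρ : 0 ≤ ρ := (norm_nonneg z).trans hz
  obtain ⟨h1, h2⟩ := norm_inv_sub_negInv_le hz hn
  have hd : (0 : ℝ) < g 1 1 := by exact_mod_cast (Mmon_bounds hg).2.1
  have hpos : 0 < |(n : ℝ)| := by linarith
  have h3 := (h g hg).2.2 (z - n) (by linarith)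
  have e : Mker g (z - n) - Mcoeff g * negInv n =
      (Mker g (z - n) - Mcoeff g / (z - n)) + Mcoeff g * ((z - n)⁻¹ - negInv n) := by
    rw [div_eq_mul_inv]; ring
  have h4 : 1 / ‖z - n‖ ^ 2 ≤ 4 * ((n : ℝ) ^ 2 + 1)⁻¹ := by
    rw [← div_eq_mul_inv, div_le_div_iff₀ (pow_pos (by linarith) 2) (by positivity), ← sq_abs (n : ℝ)]
    nlinarith
  rw [e]
  refine (norm_add_le _ _).trans ?_
  rw [norm_mul]
  have h5 := (h g hg).1
  set D := ((g 1 1 : ℝ) ^ 3)⁻¹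
  have hD : 0 < D := by positivity
  calc _ ≤ C * D * (4 * ((n : ℝ) ^ 2 + 1)⁻¹) + C * D * (4 * ρ * ((n : ℝ) ^ 2 + 1)⁻¹) := by
        refine add_le_add (h3.trans ?_) (mul_le_mul h5 h2 (norm_nonneg _) (by positivity))
        rw [div_eq_mul_one_div]
        gcongr
    _ = _ := by ring

lemma summable_Mker {z : ℂ} (hz : 0 < z.im) :
    Summable fun x : ℤ × Mmon => Mker x.2.1 (z - x.1) - Mcoeff x.2.1 * negInv x.1 := by
  obtain ⟨C, hC, h⟩ := exists_norm_Mker_sub_negInv_le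
  obtain ⟨C', hC', h'⟩ := exists_norm_Mker_le
  set ρ := ‖z‖ with hρ
  have hρ0 : 0 ≤ ρ := norm_nonneg z
  set K := C * (1 + ρ) + (C' / z.im + C') * ((2 * ρ + 8) ^ 2 + 1) with hK
  have hsum := (summable_inv_sq_add_one.mul_of_nonneg summable_Mmon_inv_cube
    (fun n => by positivity) (fun g => by
      have : (0 : ℝ) < g.1 1 1 := by exact_mod_cast (Mmon_bounds g.2).2.1
      simp only [Pi.zero_apply]; positivity)).mul_left K
  refine Summable.of_norm_bounded hsum ?_
  rintro ⟨n, g, hg⟩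
  have hd : (0 : ℝ) < g 1 1 := by exact_mod_cast (Mmon_bounds hg).2.1
  simp only
  set D := ((g 1 1 : ℝ) ^ 3)⁻¹ with hDd
  have hD : 0 < D := by positivity
  set E := ((n : ℝ) ^ 2 + 1)⁻¹ with hEd
  have hE : 0 < E := by positivity
  rcases le_or_gt (2 * ρ + 8) |(n : ℝ)| with hn | hn
  · refine (h g hg ρ z le_rfl n hn).trans ?_
    rw [hK, mul_comm D E]
    gcongr
    have : 0 ≤ (C' / z.im + C') * ((2 * ρ + 8) ^ 2 + 1) := by positivity
    linarith
  · have him : (z - n).im = z.im := by simp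
    have h1 := (h' g hg).2.1 (z - n) (by rw [him]; exact hz)
    rw [him] at h1
    have h2 := (h' g hg).1
    have h3 : 1 ≤ ((2 * ρ + 8) ^ 2 + 1) * E := by
      rw [hEd, ← div_eq_mul_inv, one_le_div (by positivity), ← sq_abs (n : ℝ)]
      gcongr
    calc _ ≤ C' * D / z.im + C' * D * 1 := by
          refine (norm_sub_le _ _).trans (add_le_add h1 ?_)
          rw [norm_mul]
          exact mul_le_mul h2 (norm_negInv_le n) (norm_nonneg _) (by positivity)
      _ = (C' / z.im + C') * D * 1 := by ring
      _ ≤ (C' / z.im + C') * D * (((2 * ρ + 8) ^ 2 + 1) * E) := by gcongr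
      _ ≤ K * (E * D) := by
          rw [hK, add_mul]
          have : 0 ≤ C * (1 + ρ) * (E * D) := by positivity
          linarith [show (C' / z.im + C') * D * (((2 * ρ + 8) ^ 2 + 1) * E) =
            (C' / z.im + C') * ((2 * ρ + 8) ^ 2 + 1) * (E * D) by ring]

lemma log_div_sub_one {w : ℂ} (hw : 0 < w.im) :
    Complex.log (w / (w - 1)) = Complex.log w - Complex.log (w - 1) := by
  have h1 : w ≠ 0 := fun h => by simp [h] at hw
  have him : 0 < (w - 1).im := by simpa using hw
  have h2 : w - 1 ≠ 0 := fun h => by simp [h] at him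
  have a1 := Complex.arg_nonneg_iff.2 hw.le
  have a2 := Complex.arg_le_pi w
  have b1 := Complex.arg_nonneg_iff.2 him.le
  have b2 : (w - 1).arg < Real.pi := Complex.arg_lt_pi_iff.2 (Or.inr him.ne')
  rw [div_eq_mul_inv, (Complex.log_mul_eq_add_log_iff h1 (inv_ne_zero h2)).2 ?_, Complex.log_inv _ b2.ne]
  · ring
  · rw [Complex.arg_inv, if_neg b2.ne]
    constructor <;> linarith

lemma summable_log_sub_negInv (z : ℂ) :
    Summable fun n : ℤ => Complex.log ((z - n) / (z - n - 1)) - negInv n := by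
  set ρ := ‖z - 1‖ with hρ
  have hρ0 : 0 ≤ ρ := norm_nonneg _
  refine Summable.of_norm_bounded_eventually (summable_inv_sq_add_one.mul_left (4 + 4 * ρ)) ?_
  have hfin : {n : ℤ | ¬ (2 * ρ + 8 ≤ |(n : ℝ)|)}.Finite := by
    refine (Set.finite_Icc (-⌈2 * ρ + 8⌉) ⌈2 * ρ + 8⌉).subset fun n hn => ?_
    have h1 : |(n : ℝ)| < 2 * ρ + 8 := not_le.1 hn
    have h2 := Int.le_ceil (2 * ρ + 8)
    obtain ⟨h3, h4⟩ := abs_lt.1 h1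
    constructor
    · have : (-(⌈2 * ρ + 8⌉ : ℤ) : ℝ) ≤ n := by linarith
      exact_mod_cast this
    · have : (n : ℝ) ≤ (⌈2 * ρ + 8⌉ : ℤ) := by linarith
      exact_mod_cast this
  refine hfin.subset fun n hn hn' => hn ?_
  obtain ⟨h1, h2⟩ := norm_inv_sub_negInv_le (le_refl ρ) hn'
  have ew : z - 1 - n = z - n - 1 := by ring
  rw [ew] at h1 h2
  set u := (z - n - 1)⁻¹ with hu
  have h0 : z - n - 1 ≠ 0 := norm_pos_iff.1 (by linarith [abs_nonneg (n : ℝ)])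
  have e : (z - n) / (z - n - 1) = 1 + u := by rw [hu]; field_simp; ring
  have hu1 : ‖u‖ ≤ 1 / 2 := by
    rw [hu, norm_inv, inv_le_comm₀ (norm_pos_iff.2 h0) (by norm_num)]
    linarith [abs_nonneg (n : ℝ)]
  have hu2 : ‖u‖ ^ 2 ≤ 4 * ((n : ℝ) ^ 2 + 1)⁻¹ := by
    rw [hu, norm_inv, ← div_eq_mul_inv, inv_pow, inv_eq_one_div,
      div_le_div_iff₀ (pow_pos (norm_pos_iff.2 h0) 2) (by positivity), ← sq_abs (n : ℝ)]
    nlinarith [abs_nonneg (n : ℝ)]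
  have h3 := Complex.norm_log_one_add_sub_self_le (z := u) (by linarith)
  have h4 : (1 - ‖u‖)⁻¹ ≤ 2 := by
    rw [inv_le_comm₀ (by linarith) (by norm_num)]; linarith
  have h5 : ‖u‖ ^ 2 * (1 - ‖u‖)⁻¹ / 2 ≤ ‖u‖ ^ 2 := by
    have := mul_le_mul_of_nonneg_left h4 (sq_nonneg ‖u‖)
    linarith
  show ‖Complex.log ((z - n) / (z - n - 1)) - negInv n‖ ≤ (4 + 4 * ρ) * ((n : ℝ) ^ 2 + 1)⁻¹
  rw [e, show Complex.log (1 + u) - negInv n = (Complex.log (1 + u) - u) + (u - negInv n) by ring]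
  refine (norm_add_le _ _).trans ?_
  linarith

lemma hasSum_log_sub_negInv {z : ℂ} (hz : 0 < z.im) :
    HasSum (fun n : ℤ => Complex.log ((z - n) / (z - n - 1)) - negInv n) (-Complex.I * Real.pi) := by
  have hs := summable_log_sub_negInv z
  have hpart : ∀ N : ℕ, ∑ n ∈ Finset.Icc (-(N : ℤ)) N,
      (Complex.log ((z - n) / (z - n - 1)) - negInv n) =
      Complex.log (z + N) - Complex.log (z - N - 1) := by
    have hl : ∀ m : ℤ, Complex.log ((z - m) / (z - m - 1)) =
        Complex.log (z - m) - Complex.log (z - m - 1) := fun m => log_div_sub_one (by simpa using hz)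
    intro N
    induction N with
    | zero =>
      have := hl 0
      simp only [Int.cast_zero, sub_zero] at this
      simp [negInv, this]
    | succ N ih =>
      push_cast
      rw [Finset.sum_Icc_succ_eq_add_endpoints, ih, hl, hl]
      simp only [negInv]
      push_cast
      rw [show z - -((N : ℂ) + 1) = z + (N + 1) by ring, show z + ((N : ℂ) + 1) - 1 = z + N by ring,
        show z - ((N : ℂ) + 1) = z - N - 1 by ring, inv_neg]
      ring
  have h1 := (hs.hasSum.comp (Finset.tendsto_Icc_neg (R := ℤ)))
  have h2 : Tendsto (fun N : ℕ => Complex.log (z + N) - Complex.log (z - N - 1)) atTop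
      (𝓝 (-Complex.I * Real.pi)) := by
    have hz0 : Tendsto (fun N : ℕ => z / N) atTop (𝓝 0) :=
      tendsto_const_div_atTop_nhds_zero_nat z
    have hz1 : Tendsto (fun N : ℕ => (z - 1) / N) atTop (𝓝 0) :=
      tendsto_const_div_atTop_nhds_zero_nat (z - 1)
    have l1 : Tendsto (fun N : ℕ => Complex.log (1 + z / N)) atTop (𝓝 0) := by
      have h : Tendsto (fun N : ℕ => 1 + z / N) atTop (𝓝 1) := by simpa using hz0.const_add 1
      simpa using h.clog (by simp)
    have l2 : Tendsto (fun N : ℕ => Complex.log (-1 + (z - 1) / N)) atTop (𝓝 (Real.pi * Complex.I)) := by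
      have h : Tendsto (fun N : ℕ => -1 + (z - 1) / N) atTop (𝓝[{w : ℂ | 0 ≤ w.im}] (-1)) := by
        refine tendsto_nhdsWithin_iff.2 ⟨by simpa using hz1.const_add (-1), .of_forall fun N => ?_⟩
        have : ((-1 : ℂ) + (z - 1) / N).im = z.im / N := by
          rw [← Complex.ofReal_natCast]
          simp
        show 0 ≤ ((-1 : ℂ) + (z - 1) / N).im
        rw [this]
        positivity
      have := (Complex.continuousWithinAt_log_of_re_neg_of_im_zero (z := -1) (by simp) (by simp)).tendsto.comp h
      rwa [Complex.log_neg_one] at this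
    have l3 := l1.sub l2
    rw [show (0 : ℂ) - Real.pi * Complex.I = -Complex.I * Real.pi by ring] at l3
    refine l3.congr' ?_
    filter_upwards [eventually_gt_atTop 0] with N hN
    have hN' : (0 : ℝ) < N := by exact_mod_cast hN
    have hNC : (N : ℂ) ≠ 0 := by exact_mod_cast hN.ne'
    have e1 : z + N = ((N : ℝ) : ℂ) * (1 + z / N) := by push_cast; field_simp; ring
    have e2 : z - N - 1 = ((N : ℝ) : ℂ) * (-1 + (z - 1) / N) := by push_cast; field_simp; ring
    have n1 : 1 + z / N ≠ 0 := fun h => by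
      rw [h, mul_zero] at e1
      have := congrArg Complex.im e1
      simp at this; linarith
    have n2 : -1 + (z - 1) / N ≠ 0 := fun h => by
      rw [h, mul_zero] at e2
      have := congrArg Complex.im e2
      simp at this; linarith
    rw [e1, e2, Complex.log_ofReal_mul hN' n1, Complex.log_ofReal_mul hN' n2]
    ring
  have h3 := tendsto_nhds_unique (h1.congr fun N => hpart N) h2
  rw [← h3]
  exact hs.hasSum

lemma hasSum_BrjunoC {z : ℂ} (hz : 0 < z.im) :
    HasSum (fun x : ℤ × Mmon => Mker x.2.1 (z - x.1) - Mcoeff x.2.1 * negInv x.1) (BrjunoC z) := by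
  have hs := summable_Mker hz
  have hinner : ∀ n : ℤ, HasSum (fun g : Mmon => Mker g.1 (z - n) - Mcoeff g.1 * negInv n)
      (sumM phi0 (z - n) - a0 * negInv n) := fun n => by
    have him : 0 < (z - n).im := by simpa using hz
    have h1 := (summable_Lop him).hasSum
    have h2 := summable_Mcoeff.hasSum.mul_right (negInv n)
    rw [a0_eq]
    refine (h1.sub h2).congr_fun fun g => ?_
    rw [Lop_phi0_eq_Mker g.2 him]
  have houter := hs.hasSum.prod_fiberwise hinner
  have hlog := (hasSum_log_sub_negInv hz).mul_left a0
  have hdiff := houter.sub hlog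
  have : BrjunoC z = ∑' x : ℤ × Mmon, (Mker x.2.1 (z - x.1) - Mcoeff x.2.1 * negInv x.1) := by
    rw [BrjunoC, BrjWith]
    rw [show (∑' n : ℤ, (sumM phi0 (z - n) - a0 * Complex.log ((z - n) / (z - n - 1)))) = _ from
      (hdiff.congr_fun fun n => by ring).tsum_eq]
    ring
  rw [this]
  exact hs.hasSum

/-- The ratio `c / d` for the pole `r` and determinant `1`. -/
noncomputable def poleRatio (r : ℚ) : ℝ := Mratio (MpoleEquiv.symm (r, true)).2.1

/-- The real part of the counterterms attached to the pole `r`. -/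
noncomputable def poleConst (r : ℚ) : ℝ :=
  (Mcoeff (MpoleEquiv.symm (r, true)).2.1 * negInv (MpoleEquiv.symm (r, true)).1 +
    Mcoeff (MpoleEquiv.symm (r, false)).2.1 * negInv (MpoleEquiv.symm (r, false)).1).re

/-- The contribution of the pole `r` to `Re 𝓑`. -/
noncomputable def poleTerm (r : ℚ) (z : ℂ) : ℝ :=
  (r.den : ℝ)⁻¹ * (pairKernel (poleRatio r) (-(r.den : ℂ) ^ 2 * (z - r))).re - poleConst r

lemma poleRatio_mem (r : ℚ) : poleRatio r ∈ Set.Icc (0 : ℝ) 1 :=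
  Mratio_mem (MpoleEquiv.symm (r, true)).2.2

lemma Mker_eq_pole (x : ℤ × Mmon) (z : ℂ) : Mker x.2.1 (z - x.1) =
    (Mdet x.2.1 : ℂ) / (Mpole x).den *
      brjKernel (Mratio x.2.1) (Mdet x.2.1 * (-((Mpole x).den : ℂ) ^ 2 * (z - Mpole x))) := by
  have hd : (x.2.1 1 1 : ℂ) = (Mpole x).den := by rw [← Mpole_den]; simp
  have hn : ((x.1 : ℂ) * x.2.1 1 1 + x.2.1 0 1) = (Mpole x).num := by rw [Mpole_num]; push_cast; rfl
  have hr : ((Mpole x : ℚ) : ℂ) = (Mpole x).num / (Mpole x).den := Rat.cast_def _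
  have h0 : ((Mpole x).den : ℂ) ≠ 0 := by exact_mod_cast (Mpole x).den_ne_zero
  rw [Mker, hd, hr]
  rw [hd] at hn
  congr 2
  rw [← hn]
  field_simp
  ring

lemma poleTerm_eq (r : ℚ) (z : ℂ) : poleTerm r z =
    (Mker (MpoleEquiv.symm (r, true)).2.1 (z - (MpoleEquiv.symm (r, true)).1) -
        Mcoeff (MpoleEquiv.symm (r, true)).2.1 * negInv (MpoleEquiv.symm (r, true)).1).re +
      (Mker (MpoleEquiv.symm (r, false)).2.1 (z - (MpoleEquiv.symm (r, false)).1) -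
        Mcoeff (MpoleEquiv.symm (r, false)).2.1 * negInv (MpoleEquiv.symm (r, false)).1).re := by
  rw [Mker_eq_pole, Mker_eq_pole, MpoleEquiv_symm_pole, MpoleEquiv_symm_pole,
    MpoleEquiv_symm_det_true, MpoleEquiv_symm_det_false, Mratio_symm_false, ← poleRatio, poleTerm,
    poleConst, pairKernel]
  simp only [Int.cast_one, one_mul, Int.cast_neg, neg_one_mul (_ * _ : ℂ)]
  rw [← Complex.ofReal_natCast, ← Complex.ofReal_one, ← Complex.ofReal_neg, ← Complex.ofReal_div,
    ← Complex.ofReal_div]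
  simp only [Complex.sub_re, Complex.add_re, Complex.re_ofReal_mul]
  ring

lemma hasSum_poleTerm {z : ℂ} (hz : 0 < z.im) :
    HasSum (fun r => poleTerm r z) (BrjunoC z).re := by
  have h := Complex.hasSum_re (hasSum_BrjunoC hz)
  have h1 := (MpoleEquiv.symm.hasSum_iff).2 h
  refine h1.prod_fiberwise fun r => ?_
  rw [poleTerm_eq]
  convert hasSum_fintype _ using 1
  rw [Fintype.sum_bool]
  rfl

/-- The size of the contribution of the pole `r` near the point `z`. -/
noncomputable def poleWeight (r : ℚ) (z : ℂ) : ℝ :=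
  (r.den : ℝ) ^ (-(1 / 2) : ℝ) * (1 + (r.den : ℝ) ^ 2 * ‖z - r‖) ^ (-(5 / 4) : ℝ)

lemma le_rpow_mul_rpow {d s A : ℝ} (hd : 1 ≤ d) (hs : 1 ≤ s) (hA : 1 ≤ A) (h : s ≤ d ^ 2 * A) :
    (d ^ 3)⁻¹ ≤ A ^ 2 * (d ^ (-(1 / 2) : ℝ) * s ^ (-(5 / 4) : ℝ)) ∧
      d⁻¹ * s⁻¹ ≤ A ^ 2 * (d ^ (-(1 / 2) : ℝ) * s ^ (-(5 / 4) : ℝ)) := by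
  have hd0 : 0 < d := by linarith
  have hs0 : 0 < s := by linarith
  have hA0 : 0 < A := by linarith
  have key : ∀ e : ℝ, 0 ≤ e → e ≤ 2 → s ^ e ≤ d ^ (2 * e) * A ^ 2 := fun e he he2 => by
    calc s ^ e ≤ (d ^ 2 * A) ^ e := Real.rpow_le_rpow hs0.le h he
      _ = d ^ (2 * e) * A ^ e := by
          rw [Real.mul_rpow (by positivity) hA0.le, ← Real.rpow_natCast d 2, ← Real.rpow_mul hd0.le]
          norm_num
      _ ≤ d ^ (2 * e) * A ^ (2 : ℝ) := by gcongr
      _ = _ := by rw [Real.rpow_two]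
  have hp : 0 < s ^ (-(5 / 4) : ℝ) := Real.rpow_pos_of_pos hs0 _
  have hq : 0 < d ^ (-(1 / 2) : ℝ) := Real.rpow_pos_of_pos hd0 _
  constructor
  · have h1 := key (5 / 4) (by norm_num) (by norm_num)
    have e1 : s ^ (5 / 4 : ℝ) * s ^ (-(5 / 4) : ℝ) = 1 := by
      rw [← Real.rpow_add hs0]; norm_num
    have e2 : d ^ (-(1 / 2) : ℝ) = (d ^ 3)⁻¹ * d ^ (2 * (5 / 4) : ℝ) := by
      rw [← Real.rpow_natCast d 3, ← Real.rpow_neg hd0.le, ← Real.rpow_add hd0]; norm_num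
    calc (d ^ 3)⁻¹ = (d ^ 3)⁻¹ * (s ^ (5 / 4 : ℝ) * s ^ (-(5 / 4) : ℝ)) := by rw [e1, mul_one]
      _ ≤ (d ^ 3)⁻¹ * (d ^ (2 * (5 / 4) : ℝ) * A ^ 2 * s ^ (-(5 / 4) : ℝ)) := by gcongr
      _ = _ := by rw [e2]; ring
  · have h1 := key (1 / 4) (by norm_num) (by norm_num)
    have e1 : s⁻¹ = s ^ (1 / 4 : ℝ) * s ^ (-(5 / 4) : ℝ) := by
      rw [← Real.rpow_add hs0, ← Real.rpow_neg_one]; norm_num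
    have e2 : d ^ (-(1 / 2) : ℝ) = d⁻¹ * d ^ (2 * (1 / 4) : ℝ) := by
      rw [← Real.rpow_neg_one, ← Real.rpow_add hd0]; norm_num
    calc d⁻¹ * s⁻¹ = d⁻¹ * (s ^ (1 / 4 : ℝ) * s ^ (-(5 / 4) : ℝ)) := by rw [e1]
      _ ≤ d⁻¹ * (d ^ (2 * (1 / 4) : ℝ) * A ^ 2 * s ^ (-(5 / 4) : ℝ)) := by gcongr
      _ = _ := by rw [e2]; ring

lemma abs_fst_sub_Mpole_le (x : ℤ × Mmon) : |(x.1 : ℝ) - Mpole x| ≤ 1 := by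
  obtain ⟨-, hd, hb, -⟩ := Mmon_bounds x.2.2
  have hd0 : (0 : ℝ) < x.2.1 1 1 := by exact_mod_cast hd
  have hb0 : (0 : ℝ) ≤ x.2.1 0 1 := by exact_mod_cast hb.1
  have hb1 : (x.2.1 0 1 : ℝ) ≤ x.2.1 1 1 := by exact_mod_cast hb.2
  have e : ((Mpole x : ℚ) : ℝ) = x.1 + x.2.1 0 1 / x.2.1 1 1 := by
    rw [Mpole]; push_cast; field_simp
  rw [e, abs_le]
  have h1 : 0 ≤ (x.2.1 0 1 : ℝ) / x.2.1 1 1 := by positivity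
  have h2 : (x.2.1 0 1 : ℝ) / x.2.1 1 1 ≤ 1 := (div_le_one hd0).2 hb1
  constructor <;> linarith

lemma exists_abs_poleTerm_le {ρ : ℝ} (hρ : 0 ≤ ρ) :
    ∃ K : ℝ, 0 < K ∧ ∀ z : ℂ, ‖z‖ ≤ ρ → ∀ r, |poleTerm r z| ≤ K * poleWeight r z := by
  obtain ⟨C₁, hC₁, h₁⟩ := exists_abs_pairKernel_le
  obtain ⟨C₂, hC₂, h₂⟩ := exists_norm_Mker_le
  obtain ⟨C₃, hC₃, h₃⟩ := exists_norm_Mker_sub_negInv_le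
  set A := 3 * ρ + 10 with hA
  refine ⟨C₁ * A ^ 2 + 2 * C₂ * A ^ 2 + 2 * C₃ * (1 + ρ) * (2 * (2 + ρ) ^ 2), by positivity,
    fun z hz r => ?_⟩
  have hW : 0 ≤ poleWeight r z := by rw [poleWeight]; positivity
  have hd1 : (1 : ℝ) ≤ r.den := by exact_mod_cast r.den_pos
  have hdd : ∀ s, ((MpoleEquiv.symm (r, s)).2.1 1 1 : ℝ) = r.den := fun s => by
    rw [MpoleEquiv_symm_den]; simp
  set d : ℝ := (r.den : ℝ) with hd
  set s : ℝ := 1 + d ^ 2 * ‖z - r‖ with hs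
  have hs1 : 1 ≤ s := by rw [hs]; linarith [show 0 ≤ d ^ 2 * ‖z - r‖ by positivity]
  have hzr : ‖z - r‖ ≤ ρ + |(r : ℝ)| := by
    refine (norm_sub_le _ _).trans (add_le_add hz (le_of_eq ?_))
    rw [← Complex.ofReal_ratCast, Complex.norm_real, Real.norm_eq_abs]
  have hn : ∀ b, |((MpoleEquiv.symm (r, b)).1 : ℝ) - r| ≤ 1 := fun b => by
    have := abs_fst_sub_Mpole_le (MpoleEquiv.symm (r, b))
    rwa [MpoleEquiv_symm_pole] at this
  rcases le_or_gt (2 * ρ + 9) |(r : ℝ)| with hr | hr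
  · have hT : ∀ b, ‖Mker (MpoleEquiv.symm (r, b)).2.1 (z - (MpoleEquiv.symm (r, b)).1) -
        Mcoeff (MpoleEquiv.symm (r, b)).2.1 * negInv (MpoleEquiv.symm (r, b)).1‖ ≤
        C₃ * (1 + ρ) * (2 * (2 + ρ) ^ 2) * poleWeight r z := fun b => by
      have hnb := hn b
      set n := (MpoleEquiv.symm (r, b)).1
      have a1 := abs_sub_abs_le_abs_sub (r : ℝ) (n : ℝ)
      rw [abs_sub_comm] at a1
      have h4 := h₃ _ (MpoleEquiv.symm (r, b)).2.2 ρ z hz n (by linarith)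
      rw [hdd] at h4
      refine h4.trans ?_
      rw [mul_assoc (C₃ * (1 + ρ))]
      refine mul_le_mul_of_nonneg_left ?_ (by positivity)
      have hn0 := abs_nonneg (n : ℝ)
      have hB1 : 1 ≤ (2 + ρ) * (1 + |(n : ℝ)|) := by nlinarith
      have hsB : s ≤ d ^ 2 * ((2 + ρ) * (1 + |(n : ℝ)|)) := by
        have : ‖z - r‖ ≤ ρ + 1 + |(n : ℝ)| := by linarith
        have e1 : 1 ≤ d ^ 2 := one_le_pow₀ hd1
        calc s ≤ d ^ 2 + d ^ 2 * (ρ + 1 + |(n : ℝ)|) := by rw [hs]; gcongr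
          _ = d ^ 2 * (2 + ρ + |(n : ℝ)|) := by ring
          _ ≤ _ := by gcongr; nlinarith
      have h5 := (le_rpow_mul_rpow hd1 hs1 hB1 hsB).1
      rw [← div_eq_mul_inv, div_le_iff₀ (by positivity)]
      refine h5.trans ?_
      rw [poleWeight, ← hd, ← hs]
      have : ((2 + ρ) * (1 + |(n : ℝ)|)) ^ 2 ≤ 2 * (2 + ρ) ^ 2 * ((n : ℝ) ^ 2 + 1) := by
        rw [mul_pow, ← sq_abs (n : ℝ)]
        nlinarith [mul_nonneg (sq_nonneg (2 + ρ)) (sq_nonneg (1 - |(n : ℝ)|))]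
      calc _ ≤ 2 * (2 + ρ) ^ 2 * ((n : ℝ) ^ 2 + 1) * (d ^ (-(1 / 2) : ℝ) * s ^ (-(5 / 4) : ℝ)) := by
            gcongr
        _ = _ := by ring
    rw [poleTerm_eq]
    refine (abs_add_le _ _).trans ?_
    have b1 := (Complex.abs_re_le_norm _).trans (hT true)
    have b2 := (Complex.abs_re_le_norm _).trans (hT false)
    have : 0 ≤ (C₁ * A ^ 2 + 2 * C₂ * A ^ 2) * poleWeight r z := by positivity
    linarith
  · have hsA : s ≤ d ^ 2 * A := by
      have : ‖z - r‖ ≤ 3 * ρ + 9 := by linarith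
      have e1 : 1 ≤ d ^ 2 := one_le_pow₀ hd1
      calc s ≤ d ^ 2 + d ^ 2 * (3 * ρ + 9) := by rw [hs]; gcongr
        _ = _ := by rw [hA]; ring
    obtain ⟨h4, h5⟩ := le_rpow_mul_rpow hd1 hs1 (by rw [hA]; linarith) hsA
    have b1 : |d⁻¹ * (pairKernel (poleRatio r) (-(r.den : ℂ) ^ 2 * (z - r))).re| ≤
        C₁ * A ^ 2 * poleWeight r z := by
      have := (h₁ _ (poleRatio_mem r)).2 (-(r.den : ℂ) ^ 2 * (z - r))
      rw [norm_mul, norm_neg, norm_pow, Complex.norm_natCast, ← hd, ← hs] at this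
      rw [abs_mul, abs_of_pos (by positivity : 0 < d⁻¹)]
      calc _ ≤ d⁻¹ * (C₁ / s) := by gcongr
        _ = C₁ * (d⁻¹ * s⁻¹) := by ring
        _ ≤ C₁ * (A ^ 2 * (d ^ (-(1 / 2) : ℝ) * s ^ (-(5 / 4) : ℝ))) := by gcongr
        _ = _ := by rw [poleWeight]; ring
    have b2 : ∀ b, ‖Mcoeff (MpoleEquiv.symm (r, b)).2.1 * negInv (MpoleEquiv.symm (r, b)).1‖ ≤
        C₂ * A ^ 2 * poleWeight r z := fun b => by
      have h6 := (h₂ _ (MpoleEquiv.symm (r, b)).2.2).1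
      rw [hdd] at h6
      rw [norm_mul]
      calc _ ≤ C₂ * (d ^ 3)⁻¹ * 1 :=
            mul_le_mul h6 (norm_negInv_le _) (norm_nonneg _) (by positivity)
        _ ≤ C₂ * (A ^ 2 * (d ^ (-(1 / 2) : ℝ) * s ^ (-(5 / 4) : ℝ))) * 1 := by gcongr
        _ = _ := by rw [poleWeight]; ring
    have b3 : |poleConst r| ≤ 2 * C₂ * A ^ 2 * poleWeight r z := by
      rw [poleConst]
      refine (Complex.abs_re_le_norm _).trans ((norm_add_le _ _).trans ?_)
      linarith [b2 true, b2 false]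
    rw [poleTerm]
    refine (abs_sub _ _).trans ?_
    have : 0 ≤ 2 * C₃ * (1 + ρ) * (2 * (2 + ρ) ^ 2) * poleWeight r z := by positivity
    linarith

/-- The dyadic block of a rational number, according to its denominator. -/
def denBlock (r : ℚ) : ℕ := Nat.log 2 r.den

lemma denBlock_bounds (r : ℚ) : (2 : ℝ) ^ denBlock r ≤ r.den ∧ (r.den : ℝ) < 2 * 2 ^ denBlock r := by
  constructor
  · exact_mod_cast Nat.pow_log_le_self 2 r.den_ne_zero
  · have := Nat.lt_pow_succ_log_self (b := 2) (by norm_num) r.den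
    rw [pow_succ'] at this
    exact_mod_cast this

lemma inv_den_mul_den_le {r r' : ℚ} (h : r ≠ r') :
    (((r.den : ℝ) * r'.den))⁻¹ ≤ |(r : ℝ) - r'| := by
  have hd : (0 : ℝ) < r.den := by exact_mod_cast r.den_pos
  have hd' : (0 : ℝ) < r'.den := by exact_mod_cast r'.den_pos
  have e : (r : ℝ) - r' = ((r.num * r'.den - r'.num * r.den : ℤ) : ℝ) / (r.den * r'.den) := by
    rw [Rat.cast_def r, Rat.cast_def r']; push_cast; field_simp
  have h0 : r.num * r'.den - r'.num * r.den ≠ 0 := by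
    intro h0
    rw [h0] at e
    apply h
    have : (r : ℝ) = r' := by simpa [sub_eq_zero] using e
    exact_mod_cast this
  rw [e, abs_div, abs_of_pos (by positivity : (0 : ℝ) < r.den * r'.den), inv_eq_one_div]
  gcongr
  exact_mod_cast Int.one_le_abs h0

lemma floor_injOn_denBlock (j : ℕ) (x : ℝ) :
    Function.Injective fun r : denBlock ⁻¹' {j} => ⌊4 * (2 ^ j : ℝ) ^ 2 * ((r : ℚ) - x)⌋ := by
  rintro ⟨r, hr⟩ ⟨r', hr'⟩ h
  by_contra hne
  have hne' : r ≠ r' := fun h' => hne (Subtype.ext h')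
  have h1 := inv_den_mul_den_le hne'
  have h2 := Int.abs_sub_lt_one_of_floor_eq_floor h
  obtain ⟨a1, a2⟩ := denBlock_bounds r
  obtain ⟨b1, b2⟩ := denBlock_bounds r'
  rw [show denBlock r = j from hr] at a1 a2
  rw [show denBlock r' = j from hr'] at b1 b2
  set Q : ℝ := 2 ^ j with hQ
  have hQ0 : 0 < Q := by positivity
  have h3 : (r.den : ℝ) * r'.den ≤ 4 * Q ^ 2 := by
    calc (r.den : ℝ) * r'.den ≤ (2 * Q) * (2 * Q) := by gcongr
      _ = _ := by ring
  have h4 : 0 < (r.den : ℝ) * r'.den := by nlinarith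
  have h5 : (4 * Q ^ 2)⁻¹ ≤ |(r : ℝ) - r'| := le_trans (by gcongr) h1
  simp only at h2
  rw [show 4 * Q ^ 2 * ((r : ℝ) - x) - 4 * Q ^ 2 * ((r' : ℝ) - x) = 4 * Q ^ 2 * ((r : ℝ) - r') by ring,
    abs_mul, abs_of_pos (by positivity : 0 < 4 * Q ^ 2)] at h2
  rw [inv_le_iff_one_le_mul₀ (by positivity)] at h5
  linarith

/-- A summable majorant on `ℤ`. -/
noncomputable def intWeight (m : ℤ) : ℝ := (1 + |(m : ℝ)|) ^ (-(5 / 4) : ℝ)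

lemma intWeight_nonneg (m : ℤ) : 0 ≤ intWeight m := by rw [intWeight]; positivity

lemma summable_intWeight : Summable intWeight := by
  have h := (Real.summable_one_div_int_add_rpow (1 / 2) (5 / 4)).2 (by norm_num)
  refine Summable.of_nonneg_of_le intWeight_nonneg (fun n => ?_) h
  have h0 : (n : ℝ) + 1 / 2 ≠ 0 := by
    intro h0
    have : (2 * n + 1 : ℝ) = 0 := by linarith
    have : (2 * n + 1 : ℤ) = 0 := by exact_mod_cast this
    omega
  rw [one_div, ← Real.rpow_neg (abs_nonneg _), intWeight]
  refine Real.rpow_le_rpow_of_nonpos (abs_pos.2 h0) ?_ (by norm_num)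
  have := abs_add_le (n : ℝ) (1 / 2)
  rw [abs_of_pos (by norm_num : (0 : ℝ) < 1 / 2)] at this
  linarith

lemma block_le_intWeight (j : ℕ) (x : ℝ) (r : ℚ) :
    (1 + (2 ^ j : ℝ) ^ 2 * |(r : ℝ) - x|) ^ (-(5 / 4) : ℝ) ≤
      16 * intWeight ⌊4 * (2 ^ j : ℝ) ^ 2 * ((r : ℚ) - x)⌋ := by
  set Q : ℝ := 2 ^ j with hQ
  set y := 4 * Q ^ 2 * ((r : ℝ) - x) with hy
  have h1 : |(⌊y⌋ : ℝ)| ≤ |y| + 1 := by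
    have a1 := Int.floor_le y
    have a2 := Int.lt_floor_add_one y
    rcases abs_cases y with h | h <;> rcases abs_cases (⌊y⌋ : ℝ) with h' | h' <;> linarith
  have h2 : |y| = 4 * (Q ^ 2 * |(r : ℝ) - x|) := by
    rw [hy, abs_mul, abs_of_nonneg (by positivity)]; ring
  set t := Q ^ 2 * |(r : ℝ) - x|
  have ht : 0 ≤ t := by positivity
  have h3 : 1 / 4 * (1 + |(⌊y⌋ : ℝ)|) ≤ 1 + t := by linarith
  have h4 : (0 : ℝ) < 1 + |(⌊y⌋ : ℝ)| := by positivity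
  calc (1 + t) ^ (-(5 / 4) : ℝ) ≤ (1 / 4 * (1 + |(⌊y⌋ : ℝ)|)) ^ (-(5 / 4) : ℝ) :=
        Real.rpow_le_rpow_of_nonpos (by positivity) h3 (by norm_num)
    _ = (1 / 4 : ℝ) ^ (-(5 / 4) : ℝ) * intWeight ⌊y⌋ := by
        rw [Real.mul_rpow (by norm_num) h4.le, intWeight]
    _ ≤ (1 / 4 : ℝ) ^ (-2 : ℝ) * intWeight ⌊y⌋ := by
        refine mul_le_mul_of_nonneg_right ?_ (intWeight_nonneg _)
        exact Real.rpow_le_rpow_of_exponent_ge (by norm_num) (by norm_num) (by norm_num)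
    _ = _ := by
        congr 1
        rw [Real.rpow_neg (by norm_num), Real.rpow_two]; norm_num

lemma poleWeight_nonneg (r : ℚ) (z : ℂ) : 0 ≤ poleWeight r z := by rw [poleWeight]; positivity

lemma abs_sub_re_le (r : ℚ) (z : ℂ) : |(r : ℝ) - z.re| ≤ ‖z - r‖ := by
  have := Complex.abs_re_le_norm (z - r)
  rw [← Complex.ofReal_ratCast] at this ⊢
  rwa [Complex.sub_re, Complex.ofReal_re, abs_sub_comm] at this

lemma poleWeight_le {j : ℕ} (r : denBlock ⁻¹' {j}) (z : ℂ) : poleWeight r z ≤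
    ((2 : ℝ) ^ (-(1 / 2) : ℝ)) ^ j *
      (16 * intWeight ⌊4 * (2 ^ j : ℝ) ^ 2 * (((r : ℚ) : ℝ) - z.re)⌋) := by
  obtain ⟨r, hr⟩ := r
  obtain ⟨a1, -⟩ := denBlock_bounds r
  rw [show denBlock r = j from hr] at a1
  refine le_trans ?_ (mul_le_mul_of_nonneg_left (block_le_intWeight j z.re r) (by positivity))
  rw [poleWeight]
  have e : ((2 : ℝ) ^ (-(1 / 2) : ℝ)) ^ j = ((2 : ℝ) ^ j) ^ (-(1 / 2) : ℝ) := by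
    rw [← Real.rpow_natCast, ← Real.rpow_natCast, ← Real.rpow_mul (by norm_num),
      ← Real.rpow_mul (by norm_num), mul_comm]
  rw [e]
  refine mul_le_mul (Real.rpow_le_rpow_of_nonpos (by positivity) a1 (by norm_num))
    (Real.rpow_le_rpow_of_nonpos (by positivity) ?_ (by norm_num)) (by positivity) (by positivity)
  gcongr
  exact abs_sub_re_le r z

lemma summable_block_poleWeight (j : ℕ) (z : ℂ) :
    Summable fun r : denBlock ⁻¹' {j} => poleWeight r z := by
  refine Summable.of_nonneg_of_le (fun r => poleWeight_nonneg _ z) (fun r => poleWeight_le r z) ?_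
  exact ((summable_intWeight.comp_injective (floor_injOn_denBlock j z.re)).mul_left 16).mul_left _

lemma tsum_block_poleWeight_le (j : ℕ) (z : ℂ) :
    ∑' r : denBlock ⁻¹' {j}, poleWeight r z ≤
      ((2 : ℝ) ^ (-(1 / 2) : ℝ)) ^ j * (16 * ∑' m, intWeight m) := by
  have hs := summable_intWeight.comp_injective (floor_injOn_denBlock j z.re)
  refine ((summable_block_poleWeight j z).tsum_le_tsum (fun r => poleWeight_le r z)
    ((hs.mul_left 16).mul_left _)).trans ?_
  rw [tsum_mul_left, tsum_mul_left]
  gcongr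
  exact tsum_comp_le_tsum_of_inj summable_intWeight intWeight_nonneg (floor_injOn_denBlock j z.re)

lemma summable_geometric_block (K : ℝ) :
    Summable fun j : ℕ => ((2 : ℝ) ^ (-(1 / 2) : ℝ)) ^ j * K :=
  (summable_geometric_of_lt_one (by positivity)
    (Real.rpow_lt_one_of_one_lt_of_neg (by norm_num) (by norm_num))).mul_right K

lemma summable_poleWeight (z : ℂ) : Summable fun r => poleWeight r z := by
  refine (summable_partition (fun r => poleWeight_nonneg r z)
    (s := fun j => denBlock ⁻¹' {j}) fun r => ⟨denBlock r, rfl, fun j hj => hj.symm⟩).2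
    ⟨fun j => summable_block_poleWeight j z, ?_⟩
  exact Summable.of_nonneg_of_le (fun j => tsum_nonneg fun r => poleWeight_nonneg _ z)
    (fun j => tsum_block_poleWeight_le j z) (summable_geometric_block _)

lemma summable_poleTerm (z : ℂ) : Summable fun r => poleTerm r z := by
  obtain ⟨K, -, h⟩ := exists_abs_poleTerm_le (norm_nonneg z)
  exact Summable.of_norm_bounded ((summable_poleWeight z).mul_left K) fun r => h z le_rfl r

lemma poleWeight_le_of_norm_le {ρ : ℝ} {z : ℂ} (hz : ‖z‖ ≤ ρ) {j : ℕ} (r : denBlock ⁻¹' {j}) :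
    poleWeight r z ≤ (1 + (2 * 2 ^ j : ℝ) ^ 2 * ρ) ^ (5 / 4 : ℝ) * poleWeight r 0 := by
  obtain ⟨r, hr⟩ := r
  obtain ⟨-, a2⟩ := denBlock_bounds r
  rw [show denBlock r = j from hr] at a2
  have hρ : 0 ≤ ρ := (norm_nonneg z).trans hz
  simp only [poleWeight]
  set d : ℝ := (r.den : ℝ)
  have hd : 0 ≤ d := Nat.cast_nonneg _
  set M := 1 + (2 * 2 ^ j : ℝ) ^ 2 * ρ with hM
  have hM1 : 1 + d ^ 2 * ρ ≤ M := by rw [hM]; gcongr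
  have h0 : 0 ≤ d ^ 2 * ρ := by positivity
  have hM0 : 0 < M := by linarith
  have h1 : ‖(0 : ℂ) - r‖ ≤ ‖z - r‖ + ρ := by
    have := norm_sub_le (z - r) z
    rw [show z - r - z = 0 - (r : ℂ) by ring] at this
    linarith
  have h2 : M⁻¹ * (1 + d ^ 2 * ‖(0 : ℂ) - r‖) ≤ 1 + d ^ 2 * ‖z - r‖ := by
    rw [inv_mul_le_iff₀ hM0]
    have h3 : 0 ≤ d ^ 2 * ‖z - r‖ := by positivity
    calc 1 + d ^ 2 * ‖(0 : ℂ) - r‖ ≤ 1 + d ^ 2 * (‖z - r‖ + ρ) := by gcongr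
      _ ≤ (1 + d ^ 2 * ρ) * (1 + d ^ 2 * ‖z - r‖) := by nlinarith
      _ ≤ _ := by gcongr
  have h4 : (1 + d ^ 2 * ‖z - r‖) ^ (-(5 / 4) : ℝ) ≤
      M ^ (5 / 4 : ℝ) * (1 + d ^ 2 * ‖(0 : ℂ) - r‖) ^ (-(5 / 4) : ℝ) := by
    refine (Real.rpow_le_rpow_of_nonpos (by positivity) h2 (by norm_num)).trans (le_of_eq ?_)
    rw [Real.mul_rpow (by positivity) (by positivity), ← Real.rpow_neg_one, ← Real.rpow_mul hM0.le]
    norm_num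
  calc _ ≤ d ^ (-(1 / 2) : ℝ) * (M ^ (5 / 4 : ℝ) * (1 + d ^ 2 * ‖(0 : ℂ) - r‖) ^ (-(5 / 4) : ℝ)) := by
        gcongr
    _ = _ := by ring

lemma tendsto_tsum_poleTerm {ι : Type*} {F : Filter ι} {Z : ι → ℂ} {ρ : ℝ}
    (hZ : ∀ᶠ i in F, ‖Z i‖ ≤ ρ) {ℓ : ℚ → ℝ} (hℓ : Summable ℓ)
    (h : ∀ r, Tendsto (fun i => poleTerm r (Z i)) F (𝓝 (ℓ r))) :
    Tendsto (fun i => ∑' r, poleTerm r (Z i)) F (𝓝 (∑' r, ℓ r)) := by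
  rcases F.eq_or_neBot with rfl | hF
  · exact tendsto_bot
  have hρ : 0 ≤ ρ := by
    obtain ⟨i, hi⟩ := hZ.exists
    exact (norm_nonneg _).trans hi
  obtain ⟨K, hK, hb⟩ := exists_abs_poleTerm_le hρ
  have e : ∀ z, ∑' r, poleTerm r z = ∑' j, ∑' r : denBlock ⁻¹' {j}, poleTerm r z := fun z =>
    ((summable_poleTerm z).hasSum.tsum_fiberwise denBlock).tsum_eq.symm
  simp_rw [e]
  rw [← (hℓ.hasSum.tsum_fiberwise denBlock).tsum_eq]
  refine tendsto_tsum_of_dominated_convergence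
    (summable_geometric_block (K * (16 * ∑' m, intWeight m))) (fun j => ?_) ?_
  · refine tendsto_tsum_of_dominated_convergence (((summable_block_poleWeight j 0).mul_left
      ((1 + (2 * 2 ^ j : ℝ) ^ 2 * ρ) ^ (5 / 4 : ℝ))).mul_left K) (fun r => h r) ?_
    filter_upwards [hZ] with i hi r
    exact (hb _ hi r).trans (mul_le_mul_of_nonneg_left (poleWeight_le_of_norm_le hi r) hK.le)
  · filter_upwards [hZ] with i hi j
    refine (tsum_of_norm_bounded ((summable_block_poleWeight j (Z i)).mul_left K).hasSum
      fun r => hb _ hi r).trans ?_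
    rw [tsum_mul_left]
    calc _ ≤ K * _ := mul_le_mul_of_nonneg_left (tsum_block_poleWeight_le j (Z i)) hK.le
      _ = _ := by ring

lemma continuousAt_poleTerm {r : ℚ} {z₀ : ℂ} (h : z₀ ≠ r) : ContinuousAt (poleTerm r) z₀ := by
  have hd : (r.den : ℂ) ≠ 0 := by exact_mod_cast r.den_ne_zero
  have h0 : -(r.den : ℂ) ^ 2 * (z₀ - r) ≠ 0 :=
    mul_ne_zero (neg_ne_zero.2 (pow_ne_zero 2 hd)) (sub_ne_zero.2 h)
  have h1 : ContinuousAt (fun z : ℂ => -(r.den : ℂ) ^ 2 * (z - r)) z₀ := by fun_prop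
  have h2 := ContinuousAt.comp (f := fun z : ℂ => -(r.den : ℂ) ^ 2 * (z - r))
    (continuousAt_pairKernel_re (poleRatio r) h0) h1
  exact (h2.const_mul _).sub_const _

/-- The common part of the directional limits of `Re 𝓑` at a rational point. -/
noncomputable def poleLimit (r₀ : ℚ) : ℝ :=
  ∑' r, poleTerm r r₀ + (r₀.den : ℝ)⁻¹ * (pairShift (poleRatio r₀) / Real.pi)

lemma tendsto_tsum_poleTerm_rat {ι : Type*} {F : Filter ι} {Z : ι → ℂ} {r₀ : ℚ} {e : ℂ}
    (hZ : Tendsto Z F (𝓝 r₀)) (hne : ∀ᶠ i in F, Z i ≠ r₀)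
    (hu : Tendsto (fun i => (Z i - r₀) / ‖Z i - r₀‖) F (𝓝 e)) (he : e ≠ 0) :
    Tendsto (fun i => ∑' r, poleTerm r (Z i)) F
      (𝓝 (poleLimit r₀ + (absArg e - Real.pi / 2) / r₀.den)) := by
  set w := (r₀.den : ℝ)⁻¹ * (pairShift (poleRatio r₀) / Real.pi + Real.pi / 2 - absArg (-e)) with hw
  have hs := (summable_poleTerm r₀).hasSum.add (hasSum_ite_eq r₀ w)
  have hbd : ∀ᶠ i in F, ‖Z i‖ ≤ ‖(r₀ : ℂ)‖ + 1 :=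
    (hZ.norm.eventually_lt_const (lt_add_one _)).mono fun i hi => hi.le
  have hd : (r₀.den : ℂ) ≠ 0 := by exact_mod_cast r₀.den_ne_zero
  have hdR : (0 : ℝ) < r₀.den := by exact_mod_cast r₀.den_pos
  have hlim : ∀ r, Tendsto (fun i => poleTerm r (Z i)) F
      (𝓝 (poleTerm r r₀ + if r = r₀ then w else 0)) := fun r => by
    by_cases hr : r = r₀
    · subst hr
      rw [if_pos rfl]
      have hX : Tendsto (fun i => -(r.den : ℂ) ^ 2 * (Z i - r)) F (𝓝 0) := by
        simpa using (hZ.sub_const (r : ℂ)).const_mul (-(r.den : ℂ) ^ 2)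
      have hX0 : ∀ᶠ i in F, -(r.den : ℂ) ^ 2 * (Z i - r) ≠ 0 := hne.mono fun i hi =>
        mul_ne_zero (neg_ne_zero.2 (pow_ne_zero 2 hd)) (sub_ne_zero.2 hi)
      have hu' : Tendsto (fun i => -(r.den : ℂ) ^ 2 * (Z i - r) / ‖-(r.den : ℂ) ^ 2 * (Z i - r)‖) F
          (𝓝 (-e)) := by
        refine hu.neg.congr fun i => ?_
        rw [norm_mul, norm_neg, norm_pow, Complex.norm_natCast]
        push_cast
        rw [neg_mul, neg_div, mul_div_mul_left _ _ (pow_ne_zero 2 hd)]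
      have := ((tendsto_pairKernel_re (poleRatio_mem r) hX hX0 hu' (neg_ne_zero.2 he)).const_mul
        (r.den : ℝ)⁻¹).sub_const (poleConst r)
      convert this using 2
      · rfl
      rw [poleTerm, sub_self, mul_zero, pairKernel_zero_right, Complex.zero_re, mul_zero, hw]
      ring
    · rw [if_neg hr, add_zero]
      refine (continuousAt_poleTerm ?_).tendsto.comp hZ
      exact_mod_cast Ne.symm hr
  have := tendsto_tsum_poleTerm hbd hs.summable hlim
  rw [hs.tsum_eq] at this
  convert this using 2
  rw [poleLimit, hw, absArg_neg]
  field_simp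
  ring

/-- boundary behaviour of the real part of the complex Brjuno function:
its trace on `ℝ` exists at irrational points, along each ray at a rational `p/q` the
limit is `c_{p/q} − θ/q`, and the trace has a decreasing jump of `π/q` at `p/q`. -/
theorem re_brjuno_boundary_trace :
    ∃ L : ℝ → ℝ,
      (∀ α : ℝ, Irrational α →
        Tendsto (fun z => (BrjunoC z).re) (nhdsWithin (α : ℂ) {z : ℂ | 0 < z.im})
          (nhds (L α))) ∧
      ∀ p q : ℤ, 0 < q → IsCoprime p q →
        ∃ c : ℝ,
          (∀ θ : ℝ, -(Real.pi / 2) < θ → θ < Real.pi / 2 →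
            Tendsto
              (fun r : ℝ =>
                (BrjunoC (((p : ℝ) / (q : ℝ) : ℝ) +
                  (r : ℂ) * Complex.exp (Complex.I * ((Real.pi / 2 - θ : ℝ) : ℂ)))).re)
              (nhdsWithin 0 (Set.Ioi 0)) (nhds (c - θ / (q : ℝ)))) ∧
          Tendsto L
            (nhdsWithin ((p : ℝ) / (q : ℝ))
              ({x : ℝ | Irrational x} ∩ Set.Ioi ((p : ℝ) / (q : ℝ))))
            (nhds (c - Real.pi / (2 * (q : ℝ)))) ∧
          Tendsto L
            (nhdsWithin ((p : ℝ) / (q : ℝ))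
              ({x : ℝ | Irrational x} ∩ Set.Iio ((p : ℝ) / (q : ℝ))))
            (nhds (c + Real.pi / (2 * (q : ℝ)))) := by
  refine ⟨fun α => ∑' r, poleTerm r α, fun α hα => ?_, fun p q hq hpq => ?_⟩
  · have hid : Tendsto (fun z : ℂ => z) (𝓝[{z : ℂ | 0 < z.im}] (α : ℂ)) (𝓝 α) :=
      tendsto_id'.2 nhdsWithin_le_nhds
    have hbd : ∀ᶠ z in 𝓝[{z : ℂ | 0 < z.im}] (α : ℂ), ‖z‖ ≤ ‖(α : ℂ)‖ + 1 :=
      (hid.norm.eventually_lt_const (lt_add_one _)).mono fun i hi => hi.le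
    refine (tendsto_tsum_poleTerm hbd (summable_poleTerm α) fun r =>
      (continuousAt_poleTerm ?_).tendsto.comp hid).congr' ?_
    · rw [← Complex.ofReal_ratCast]
      exact fun h => hα ⟨r, (Complex.ofReal_injective h).symm⟩
    · filter_upwards [self_mem_nhdsWithin] with z hz using (hasSum_poleTerm hz).tsum_eq
  set r₀ : ℚ := (p : ℚ) / (q : ℚ) with hr₀
  have hden : (r₀.den : ℝ) = q := by
    have : (r₀.den : ℤ) = q := Rat.den_div_eq_of_coprime hq (Int.isCoprime_iff_gcd_eq_one.1 hpq)
    exact_mod_cast this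
  have hqR : (0 : ℝ) < q := by exact_mod_cast hq
  have hx : (p : ℝ) / (q : ℝ) = r₀ := by rw [hr₀]; push_cast; rfl
  have hxC : ((r₀ : ℝ) : ℂ) = r₀ := Complex.ofReal_ratCast r₀
  rw [hx]
  refine ⟨poleLimit r₀, fun θ h1 h2 => ?_, ?_, ?_⟩
  · set e := Complex.exp (Complex.I * ((Real.pi / 2 - θ : ℝ) : ℂ)) with he
    have he1 : ‖e‖ = 1 := by rw [he, mul_comm]; exact Complex.norm_exp_ofReal_mul_I _
    have he0 : e ≠ 0 := norm_pos_iff.1 (by rw [he1]; norm_num)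
    have harg : e.arg = Real.pi / 2 - θ := by
      rw [he, mul_comm]
      rw [Complex.arg_exp_mul_I, toIocMod_eq_self]
      exact ⟨by linarith, by linarith⟩
    have him : 0 < e.im := by
      rw [he, mul_comm, Complex.exp_ofReal_mul_I_im]
      exact Real.sin_pos_of_pos_of_lt_pi (by linarith) (by linarith)
    have hpos : ∀ᶠ r : ℝ in 𝓝[>] 0, 0 < r := self_mem_nhdsWithin
    have hZ : Tendsto (fun r : ℝ => ((r₀ : ℝ) : ℂ) + (r : ℂ) * e) (𝓝[>] 0) (𝓝 r₀) := by
      have : Continuous fun r : ℝ => ((r₀ : ℝ) : ℂ) + (r : ℂ) * e := by fun_prop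
      have := this.tendsto 0
      simp only [Complex.ofReal_zero, zero_mul, add_zero, hxC] at this
      simpa only [hxC] using this.mono_left nhdsWithin_le_nhds
    have h3 := tendsto_tsum_poleTerm_rat (e := e) hZ ?_ ?_ he0
    · rw [absArg_eq he0, harg, abs_of_pos (by linarith), hden] at h3
      rw [show poleLimit r₀ - θ / q = poleLimit r₀ + (Real.pi / 2 - θ - Real.pi / 2) / q by ring]
      refine h3.congr' ?_
      filter_upwards [hpos] with r hr
      refine (hasSum_poleTerm ?_).tsum_eq
      rw [Complex.add_im, Complex.ofReal_im, zero_add, Complex.im_ofReal_mul]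
      positivity
    · filter_upwards [hpos] with r hr
      rw [hxC, Ne, add_eq_left]
      exact mul_ne_zero (by exact_mod_cast hr.ne') he0
    · refine tendsto_const_nhds.congr' ?_
      filter_upwards [hpos] with r hr
      have hrC : (r : ℂ) ≠ 0 := by exact_mod_cast hr.ne'
      rw [hxC, add_sub_cancel_left, norm_mul, he1, mul_one, Complex.norm_real, Real.norm_eq_abs,
        abs_of_pos hr, mul_div_cancel_left₀ _ hrC]
  · have hid : Tendsto (fun x : ℝ => (x : ℂ)) (𝓝[{x : ℝ | Irrational x} ∩ Set.Ioi (r₀ : ℝ)] (r₀ : ℝ))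
        (𝓝 r₀) := by
      rw [← hxC]
      exact (Complex.continuous_ofReal.tendsto _).mono_left nhdsWithin_le_nhds
    have hmem : ∀ᶠ x : ℝ in 𝓝[{x : ℝ | Irrational x} ∩ Set.Ioi (r₀ : ℝ)] (r₀ : ℝ), (r₀ : ℝ) < x := by
      filter_upwards [self_mem_nhdsWithin] with x hx using hx.2
    have h3 := tendsto_tsum_poleTerm_rat (e := 1) hid ?_ ?_ one_ne_zero
    · rw [absArg_eq one_ne_zero, Complex.arg_one, abs_zero, hden] at h3
      convert h3 using 2
      field_simp
      ring
    · filter_upwards [hmem] with x hx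
      rw [← hxC]
      exact_mod_cast hx.ne'
    · refine tendsto_const_nhds.congr' ?_
      filter_upwards [hmem] with x hx
      have h0 : (x : ℂ) - r₀ ≠ 0 := by
        rw [← hxC, sub_ne_zero]; exact_mod_cast hx.ne'
      rw [← hxC, ← Complex.ofReal_sub, Complex.norm_real, Real.norm_eq_abs, abs_of_pos (by linarith),
        div_self]
      rwa [Complex.ofReal_sub, hxC]
  · have hid : Tendsto (fun x : ℝ => (x : ℂ)) (𝓝[{x : ℝ | Irrational x} ∩ Set.Iio (r₀ : ℝ)] (r₀ : ℝ))
        (𝓝 r₀) := by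
      rw [← hxC]
      exact (Complex.continuous_ofReal.tendsto _).mono_left nhdsWithin_le_nhds
    have hmem : ∀ᶠ x : ℝ in 𝓝[{x : ℝ | Irrational x} ∩ Set.Iio (r₀ : ℝ)] (r₀ : ℝ), x < (r₀ : ℝ) := by
      filter_upwards [self_mem_nhdsWithin] with x hx using hx.2
    have he0 : (-1 : ℂ) ≠ 0 := neg_ne_zero.2 one_ne_zero
    have h3 := tendsto_tsum_poleTerm_rat (e := -1) hid ?_ ?_ he0
    · rw [absArg_eq he0, Complex.arg_neg_one, abs_of_pos Real.pi_pos, hden] at h3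
      convert h3 using 2
      field_simp
      ring
    · filter_upwards [hmem] with x hx
      rw [← hxC]
      exact_mod_cast hx.ne
    · refine tendsto_const_nhds.congr' ?_
      filter_upwards [hmem] with x hx
      have h0 : (x : ℂ) - r₀ ≠ 0 := by
        rw [← hxC, sub_ne_zero]; exact_mod_cast hx.ne
      rw [← hxC, ← Complex.ofReal_sub, Complex.norm_real, Real.norm_eq_abs, abs_of_neg (by linarith),
        Complex.ofReal_neg, div_neg, div_self]
      rwa [Complex.ofReal_sub, hxC]
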